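/- arXiv:math/0109140 — 2 statements merged into one kernel-verified Lean document; each statement's English description precedes it below -/
import Mathlib

section
/- For every odd integer m ≥ 1 and every u ∈ ℂ: ξ^{(n+1)}_m(u) = 0. -/
attribute [local instance 10] Classical.propDecidable

noncomputable section

open Finset

variable {K : Type*} [CommRing K]

/-- `Y_a(u)` as a unit of `K`, with `Y_0(u) = 1`, where
`Y_a(u) = Q_a(u - d_a) Q_a(u + d_a)⁻¹`, `d_a = 1/2` for `a < n` and `d_n = 1`. -/
def Yq (n : ℕ) (Q : ℕ → ℂ → Kˣ) (a : ℕ) (u : ℂ) : Kˣ :=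
  if a = 0 then 1
  else Q a (u - (if a = n then 1 else 2⁻¹)) * (Q a (u + (if a = n then 1 else 2⁻¹)))⁻¹

/-- `z_i(u)` for `i = 1,…,2n`, where `i ≤ n` encodes the letter `i` of the alphabet
`J = {1 ≺ ⋯ ≺ n ≺ n̄ ≺ ⋯ ≺ 1̄}`, and `i > n` encodes the letter `\overline{2n+1-i}`. -/
def zq (n : ℕ) (Q : ℕ → ℂ → Kˣ) (i : ℕ) (u : ℂ) : Kˣ :=
  if i ≤ n then
    Yq n Q i (u + (i : ℂ) / 2) * (Yq n Q (i - 1) (u + ((i : ℂ) + 1) / 2))⁻¹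
  else
    Yq n Q (2 * n - i) (u + ((i : ℂ) + 2) / 2) *
      (Yq n Q (2 * n + 1 - i) (u + ((i : ℂ) + 3) / 2))⁻¹

/-- the common value `x_{n+1}(u) = -x_{n+2}(u)
  = Q_n(u+n/2) Q_n(u+(n+4)/2) Q_n(u+(n+2)/2)⁻²`. -/
def xqmid (n : ℕ) (Q : ℕ → ℂ → Kˣ) (u : ℂ) : K :=
  (Q n (u + (n : ℂ) / 2) : K) * (Q n (u + ((n : ℂ) + 4) / 2) : K) *
    (((Q n (u + ((n : ℂ) + 2) / 2))⁻¹ : Kˣ) : K) ^ 2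

/-- `x_i(u)` for `i = 1,…,N = 2n+2`. -/
def xq (n : ℕ) (Q : ℕ → ℂ → Kˣ) (i : ℕ) (u : ℂ) : K :=
  if i ≤ n then zq n Q i u
  else if i = n + 1 then xqmid n Q u
  else if i = n + 2 then -xqmid n Q u
  else zq n Q (i - 2) u

/-- admissibility of a column tableau: whenever `i_k = c` and `i_l = \bar c`
for some `1 ≤ c ≤ n`, one has `n + k - l ≥ c` (letters encoded as in `zq`,
positions `0`-based, which does not change the difference `k - l`). -/
def AdmQ (n : ℕ) {a : ℕ} (t : Fin a → Fin (2 * n)) : Prop :=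
  ∀ k l : Fin a, ((t k : ℕ) + 1 ≤ n) → ((t l : ℕ) + 1 = 2 * n + 1 - ((t k : ℕ) + 1)) →
    (((t k : ℕ) + 1 : ℤ)) ≤ (n : ℤ) + (k : ℕ) - (l : ℕ)

/-- the column tableau sum: `tabSumQ n Q a v = T^{(a)}_1(v)` for `0 ≤ a ≤ n`, i.e.
`T^{(a)}_1(u + 1/2) = ∑ z_{i_1}(u + (a-1)/2) ⋯ z_{i_a}(u - (a-1)/2)` over strictly
increasing admissible tableaux. -/
def tabSumQ (n : ℕ) (Q : ℕ → ℂ → Kˣ) (a : ℕ) (v : ℂ) : K :=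
  ∑ t ∈ univ.filter (fun t : Fin a → Fin (2 * n) => StrictMono t ∧ AdmQ n t),
    ∏ k : Fin a,
      (zq n Q ((t k : ℕ) + 1) (v + ((a : ℂ) - 2 * (((k : ℕ) : ℂ) + 1)) / 2) : K)

/-- `T^{(a)}_1(v)` for all `a ∈ ℤ`: the fundamental `q`-characters for `1 ≤ a ≤ n`,
extended by `T^{(0)}_1 = 1`, `T^{(a)}_1 = 0` for `a < 0`, and
`T^{(a)}_1(u) + T^{(N-a)}_1(u) = 0`. -/
def T1q (n : ℕ) (Q : ℕ → ℂ → Kˣ) (a : ℤ) (v : ℂ) : K :=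
  if a < 0 then 0
  else if a ≤ (n : ℤ) then tabSumQ n Q a.toNat v
  else if a = (n : ℤ) + 1 then 0
  else if a ≤ 2 * (n : ℤ) + 2 then -tabSumQ n Q (2 * (n : ℤ) + 2 - a).toNat v
  else 0

/-- left-to-right composition of a list of difference operators. -/
def opProd (l : List ((ℂ → K) → (ℂ → K))) : (ℂ → K) → (ℂ → K) :=
  l.foldr (· ∘ ·) id

/-- the operator `L(u) = (M_{x_1(⋅+n)} - D)(M_{x_2(⋅+n-1)} - D) ⋯ (M_{x_N(⋅+n+1-N)} - D)`,
where `D` is the shift `(Df)(u) = f(u+1)` and `M_g` is multiplication by `g`. -/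
def Lq (n : ℕ) (Q : ℕ → ℂ → Kˣ) : (ℂ → K) → (ℂ → K) :=
  opProd ((List.range (2 * n + 2)).map fun j =>
    fun f u => xq n Q (j + 1) (u + (n : ℂ) - (j : ℂ)) * f u - f (u + 1))

/-- `ε_i = -1` for `i = n+1, n+2` and `= 1` otherwise. -/
def epsq (n : ℕ) (i : ℕ) : K := if i = n + 1 ∨ i = n + 2 then -1 else 1

/-- `L_j`, the left-to-right composition over `i = N+1-j, …, N` of the operators
`D - ε_i M_{x_i(⋅+n+1-i)}`. -/
def Ljq (n : ℕ) (Q : ℕ → ℂ → Kˣ) (j : ℕ) : (ℂ → K) → (ℂ → K) :=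
  opProd ((List.range j).map fun r =>
    fun f u => f (u + 1) -
      epsq n (2 * n + 3 - j + r) * xq n Q (2 * n + 3 - j + r)
        (u + (n : ℂ) + 1 - ((2 * n + 3 - j + r : ℕ) : ℂ)) * f u)

/-- the Casorati determinant `det_{1 ≤ r,s ≤ j} (w_r(u + s - 1))`
(for a family `w` indexed by `1, 2, …`). -/
def casq (w : ℕ → ℂ → K) (j : ℕ) (u : ℂ) : K :=
  Matrix.det (Matrix.of fun r s : Fin j => w ((r : ℕ) + 1) (u + ((s : ℕ) : ℂ)))

/-- `ξ^{(a)}_m(u)`: the determinant of the `N × N` matrix whose columns are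
`(w_j(u+c))_j` for `c` running over `(0, 1, …, a-1, a+m, a+m+1, …, N+m-1)`. -/
def xiq (n : ℕ) (w : ℕ → ℂ → K) (a m : ℕ) (u : ℂ) : K :=
  Matrix.det (Matrix.of fun j r : Fin (2 * n + 2) =>
    w ((j : ℕ) + 1) (u + ((if (r : ℕ) < a then (r : ℕ) else (r : ℕ) + m : ℕ) : ℂ)))

/-- Shifting the summation index does not change the sum of a function supported in `[-r, r]`. -/
lemma sum_Icc_shift {G : ℤ → K} {r : ℤ} (hG : ∀ j, r < |j| → G j = 0) (d : ℤ) (hd : |d| ≤ 1) :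
    ∑ j ∈ Icc (-(r + 1)) (r + 1), G (j + d) = ∑ j ∈ Icc (-r) r, G j := by
  rw [abs_le] at hd
  have h : ∑ j ∈ Icc (-(r + 1)) (r + 1), G (j + d) =
      ∑ j ∈ Icc (-(r + 1) + d) (r + 1 + d), G j := by
    rw [← Finset.map_add_right_Icc, Finset.sum_map]
    rfl
  rw [h]
  symm
  apply Finset.sum_subset
  · intro j hj
    rw [Finset.mem_Icc] at hj ⊢
    omega
  · intro j _ hj
    apply hG
    rw [Finset.mem_Icc] at hj
    rw [lt_abs]
    omega

/-- The coefficients of the difference operator `-P X P*`, where `X = ∑ e_j D^j`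
and `P* = 1 - M_a D`. -/
def dressCoeff (a : ℂ → K) (e : ℤ → ℂ → K) (j : ℤ) (u : ℂ) : K :=
  -(e j u - e (j - 1) u * a (u + j - 1) -
    a (u - 1) * (e (j + 1) (u - 1) - e j (u - 1) * a (u + j - 1)))

lemma dressCoeff_antisymm {a : ℂ → K} {e : ℤ → ℂ → K} (h : ∀ j u, e (-j) u = -e j (u - j))
    (j : ℤ) (u : ℂ) : dressCoeff a e (-j) u = -dressCoeff a e j (u - j) := by
  have h₁ : e (-j - 1) u = -e (j + 1) (u - j - 1) := by
    rw [show -j - 1 = -(j + 1) by ring, h]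
    congr 2
    push_cast
    ring
  have h₂ : e (-j + 1) (u - 1) = -e (j - 1) (u - j) := by
    rw [show -j + 1 = -(j - 1) by ring, h]
    congr 2
    push_cast
    ring
  have h₃ : e (-j) (u - 1) = -e j (u - j - 1) := by
    rw [h]
    congr 2
    ring
  simp only [dressCoeff, h₁, h₂, h₃, h j u]
  rw [show u + ((-j : ℤ) : ℂ) - 1 = u - j - 1 by push_cast; ring,
    show u - (j : ℂ) + j - 1 = u - 1 by ring]
  ring

lemma dressCoeff_eq_zero {a : ℂ → K} {e : ℤ → ℂ → K} {r : ℤ} (h : ∀ j u, r < |j| → e j u = 0)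
    (j : ℤ) (u : ℂ) (hj : r + 1 < |j|) : dressCoeff a e j u = 0 := by
  rw [lt_abs] at hj
  have h' : ∀ j u, (r < j ∨ r < -j) → e j u = 0 := fun j u hj => h j u (lt_abs.2 hj)
  rw [dressCoeff, h' j u (by omega), h' (j - 1) u (by omega), h' (j + 1) _ (by omega),
    h' j _ (by omega)]
  ring

lemma dressCoeff_top {a : ℂ → K} {e : ℤ → ℂ → K} {r : ℤ} (h : ∀ j u, r < |j| → e j u = 0)
    (u : ℂ) :
    dressCoeff a e (r + 1) u = e r u * a (u + r) := by
  have h' : ∀ j u, (r < j ∨ r < -j) → e j u = 0 := fun j u hj => h j u (lt_abs.2 hj)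
  rw [dressCoeff, h' (r + 1) u (by omega), h' (r + 1 + 1) _ (by omega),
    h' (r + 1) _ (by omega), show r + 1 - 1 = r by ring,
    show u + ((r + 1 : ℤ) : ℂ) - 1 = u + r by push_cast; ring]
  ring

lemma sum_dressCoeff {a : ℂ → K} {e : ℤ → ℂ → K} {r : ℤ} (h : ∀ j u, r < |j| → e j u = 0)
    (f : ℂ → K) (u : ℂ) :
    ∑ j ∈ Icc (-(r + 1)) (r + 1), dressCoeff a e j u * f (u + j) =
      -(∑ j ∈ Icc (-r) r, e j u * (f (u + j) - a (u + j) * f (u + j + 1)) -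
        a (u - 1) * ∑ j ∈ Icc (-r) r,
          e j (u - 1) * (f (u - 1 + j) - a (u - 1 + j) * f (u - 1 + j + 1))) := by
  simp only [mul_sub, Finset.sum_sub_distrib]
  have key (g : ℤ → K) (v : ℂ) (d : ℤ) (hd : |d| ≤ 1) :=
    sum_Icc_shift (G := fun j => e j v * g j) (r := r) (fun j hj => by simp [h j v hj]) d hd
  rw [← key (fun j => f (u + j)) u 0 (by norm_num),
    ← key (fun j => a (u + j) * f (u + j + 1)) u (-1) (by norm_num),
    ← key (fun j => f (u - 1 + j)) (u - 1) 1 (by norm_num),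
    ← key (fun j => a (u - 1 + j) * f (u - 1 + j + 1)) (u - 1) 0 (by norm_num)]
  simp only [Finset.mul_sum, ← Finset.sum_sub_distrib, ← Finset.sum_neg_distrib]
  refine Finset.sum_congr rfl fun j _ => ?_
  rw [dressCoeff]
  push_cast
  rw [show u + ((j : ℂ) + -1) = u + j - 1 by ring, show u + (j : ℂ) - 1 + 1 = u + j by ring,
    show u - 1 + ((j : ℂ) + 1) = u + j by ring,
    show u - 1 + ((j : ℂ) + 0) = u + j - 1 by ring, show u + (j : ℂ) - 1 + 1 = u + j by ring,
    add_zero, add_zero, ← sub_eq_add_neg]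
  ring

/-- The first order difference operator `D - M_κ`. -/
def shiftSub (κ : ℂ → K) (f : ℂ → K) (u : ℂ) : K := f (u + 1) - κ u * f u

lemma opProd_cons {A : Type*} (T : (ℂ → A) → ℂ → A) (l : List ((ℂ → A) → ℂ → A)) (f : ℂ → A) :
    opProd (T :: l) f = T (opProd l f) := rfl

lemma opProd_append_singleton {A : Type*} (l : List ((ℂ → A) → ℂ → A)) (T : (ℂ → A) → ℂ → A)
    (f : ℂ → A) :
    opProd (l ++ [T]) f = opProd l (T f) := by
  induction l with
  | nil => rfl
  | cons S l ih => rw [List.cons_append, opProd_cons, opProd_cons, ih]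

lemma opProd_map_shiftSub_neg (κ : ℕ → ℂ → K) (l : List ℕ) (f : ℂ → K) (u : ℂ) :
    opProd (l.map fun i => shiftSub (κ i)) (fun v => -f v) u =
      -opProd (l.map fun i => shiftSub (κ i)) f u := by
  induction l generalizing u with
  | nil => rfl
  | cons i l ih =>
    rw [List.map_cons, opProd_cons, opProd_cons, shiftSub, shiftSub, ih, ih]
    ring

/-- A product of first order operators with palindromic factors around a middle factor
`D² - M_h` is, after a shift and a gauge transformation, antisymmetric. -/
lemma exists_antisymm_coeff {n : ℕ} {κ : ℕ → ℂ → K} {H : ℕ → ℂ → Kˣ} {μ : ℂ → K}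
    (hα : ∀ a, 1 ≤ a → a ≤ n → ∀ v,
      κ a v = (H a (v + n + 1 - a) * (H (a - 1) (v + n + 2 - a))⁻¹ : Kˣ))
    (hβ : ∀ a, 1 ≤ a → a ≤ n → ∀ v, κ (2 * n + 3 - a) v = (H (a - 1) v * (H a v)⁻¹ : Kˣ))
    (hμ₁ : ∀ v, κ (n + 1) v = -μ v) (hμ₂ : ∀ v, κ (n + 2) v = μ (v - 1))
    (hμ : ∀ v, μ v * μ (v - 1) = (H n v * (H n (v + 1))⁻¹ : Kˣ))
    (s : ℕ) (hs : s ≤ n) :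
    ∃ e : ℤ → ℂ → K, (∀ j u, e (-j) u = -e j (u - j)) ∧
      (∀ j u, ((s : ℤ) + 1) < |j| → e j u = 0) ∧
      (∀ u, e (s + 1) u = ((H (n - s) (u + s + 1))⁻¹ : Kˣ)) ∧
      ∀ (f : ℂ → K) (u : ℂ), ∑ j ∈ Icc (-((s : ℤ) + 1)) (s + 1), e j u * f (u + j) =
        opProd ((List.range' (n + 1 - s) (2 * s + 2)).map fun i => shiftSub (κ i))
          (fun v => ((H (n - s) v)⁻¹ : Kˣ) * f v) (u - s - 1) := by
  induction s with
  | zero =>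
    refine ⟨fun j u => if j = 1 then ((H n (u + 1))⁻¹ : Kˣ)
      else if j = -1 then -((H n u)⁻¹ : Kˣ) else 0, ?_, ?_, ?_, ?_⟩
    · intro j u
      by_cases h1 : j = 1
      · subst h1
        simp
      · by_cases h2 : j = -1
        · subst h2
          simp
        · have h3 : -j ≠ 1 := by omega
          simp [h1, h2, h3]
    · intro j u hj
      rw [lt_abs] at hj
      simp only [Nat.cast_zero, zero_add] at hj
      have h1 : j ≠ 1 := by omega
      have h2 : j ≠ -1 := by omega
      simp [h1, h2]
    · intro u
      simp
    · intro f u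
      have hI : Icc (-(((0 : ℕ) : ℤ) + 1)) ((0 : ℕ) + 1) = {-1, 0, 1} := by decide
      have hL : List.range' (n + 1 - 0) (2 * 0 + 2) = [n + 1, n + 2] := rfl
      have hh : μ (u - 1) * μ (u - 1 - 1) * ((H n (u - 1))⁻¹ : Kˣ) = ((H n u)⁻¹ : Kˣ) := by
        rw [hμ, ← Units.val_mul, sub_add_cancel]
        congr 1
        rw [mul_right_comm, mul_inv_cancel, one_mul]
      rw [hI, hL]
      simp only [List.map_cons, List.map_nil, opProd_cons, shiftSub, hμ₁, hμ₂]
      simp only [opProd, List.foldr_nil, id]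
      simp
      rw [← sub_eq_add_neg, ← hh]
      ring
  | succ s ih =>
    obtain ⟨e, hanti, hsupp, htop, hact⟩ := ih (by omega)
    obtain ⟨a, ha⟩ : ∃ a, a = n - s := ⟨_, rfl⟩
    have ha1 : n - (s + 1) = a - 1 := by omega
    have hac : (a : ℂ) = n - s := by
      rw [ha, Nat.cast_sub (by omega)]
    rw [← ha] at htop hact
    rw [ha1]
    let t : ℂ → K := fun v => (H a v * (H (a - 1) (v + 1))⁻¹ : Kˣ)
    refine ⟨dressCoeff t e, dressCoeff_antisymm hanti, ?_, ?_, ?_⟩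
    · intro j u hj
      exact dressCoeff_eq_zero hsupp j u (by push_cast at hj; exact hj)
    · intro u
      have := dressCoeff_top (a := t) hsupp u
      push_cast
      rw [this, htop, ← Units.val_mul]
      congr 1
      push_cast
      simp only [← add_assoc]
      rw [inv_mul_cancel_left]
    · intro f u
      have hlist : List.range' (n + 1 - (s + 1)) (2 * (s + 1) + 2) =
          a :: (List.range' (n + 1 - s) (2 * s + 2) ++ [2 * n + 3 - a]) := by
        rw [show n + 1 - (s + 1) = a by omega, show n + 1 - s = a + 1 by omega,
          show 2 * (s + 1) + 2 = (2 * s + 2 + 1) + 1 by omega, List.range'_succ,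
          List.range'_concat]
        congr 3
        omega
      have hP : ∀ v : ℂ, ((H a v)⁻¹ : Kˣ) * (f v - t v * f (v + 1)) =
          -shiftSub (κ (2 * n + 3 - a)) (fun v => ((H (a - 1) v)⁻¹ : Kˣ) * f v) v := by
        intro v
        have e1 : (((H a v)⁻¹ : Kˣ) : K) * t v = ((H (a - 1) (v + 1))⁻¹ : Kˣ) := by
          simp only [t]
          rw [← Units.val_mul, inv_mul_cancel_left]
        have e2 : κ (2 * n + 3 - a) v * ((H (a - 1) v)⁻¹ : Kˣ) = ((H a v)⁻¹ : Kˣ) := by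
          rw [hβ a (by omega) (by omega), ← Units.val_mul, mul_right_comm, mul_inv_cancel,
            one_mul]
        rw [shiftSub, ← mul_assoc, e2, ← e1]
        ring
      have hA : ∀ g : ℂ → K, shiftSub (κ a) g (u - s - 1 - 1) =
          g (u - s - 1) - t (u - 1) * g (u - 1 - s - 1) := by
        intro g
        have e1 : u - s - 1 - 1 + n + 1 - (a : ℂ) = u - 1 := by
          rw [hac]
          ring
        have e2 : u - s - 1 - 1 + n + 2 - (a : ℂ) = u - 1 + 1 := by
          rw [hac]
          ring
        rw [shiftSub, hα a (by omega) (by omega), e1, e2,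
          show u - s - 1 - 1 + 1 = u - s - 1 by ring,
          show u - 1 - s - 1 = u - s - 1 - 1 by ring]
      have hneg := opProd_map_shiftSub_neg κ (List.range' (n + 1 - s) (2 * s + 2))
      rw [hlist]
      push_cast
      rw [sum_dressCoeff hsupp, hact (fun v => f v - t v * f (v + 1)),
        hact (fun v => f v - t v * f (v + 1)) (u - 1), List.map_cons, List.map_append,
        List.map_singleton, opProd_cons, opProd_append_singleton,
        show u - ((s : ℂ) + 1) - 1 = u - s - 1 - 1 by ring, hA]
      simp only [hP, hneg]
      ring

/-- The Gram matrix `Γ` of a sequence of vectors, seen from its first `2p` entries: two isotropic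
blocks of length `p`, dual to each other up to the triangular matrix `x`. -/
structure GramWindow (p : ℕ) (x Γ : ℕ → ℕ → K) : Prop where
  isotropic_left : ∀ i < p, ∀ j < p, Γ i j = 0
  isotropic_right : ∀ i < p, ∀ j < p, Γ (p + i) (p + j) = 0
  dual : ∀ i < p, ∀ j < p,
    ∑ l ∈ range p, x i (p + l) * Γ (p + l) j = if i = j then 1 else 0

lemma GramWindow.dual' {p : ℕ} {x Γ : ℕ → ℕ → K} (h : GramWindow p x Γ) (i : ℕ) (hi : i < p)
    (j : ℕ) (hj : j < p) :
    ∑ l ∈ range p, Γ (p + i) l * x l (p + j) = if i = j then 1 else 0 := by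
  have h1 : (Matrix.of fun i l : Fin p => x i (p + l)) *
      (Matrix.of fun l j : Fin p => Γ (p + l) j) = 1 := by
    ext i j
    rw [Matrix.mul_apply, Matrix.one_apply]
    simp only [Matrix.of_apply, Fin.ext_iff]
    rw [Fin.sum_univ_eq_sum_range (fun l => x i (p + l) * Γ (p + l) j) p]
    exact h.dual i i.2 j j.2
  have h2 := congrArg (fun A : Matrix (Fin p) (Fin p) K => A ⟨i, hi⟩ ⟨j, hj⟩) (mul_eq_one_comm.1 h1)
  simp only [Matrix.mul_apply, Matrix.one_apply] at h2
  simp only [Matrix.of_apply, Fin.ext_iff] at h2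
  rw [Fin.sum_univ_eq_sum_range (fun l => Γ (p + i) l * x l (p + j)) p] at h2
  exact h2

lemma GramWindow.succ {p : ℕ} (hp : 0 < p) {x Γ : ℕ → ℕ → K} (hsym : ∀ i j, Γ i j = Γ j i)
    (hx0 : ∀ k j, k + p < j → x k j = 0) (hx1 : ∀ k, x k (k + p) = 1)
    (hanti : ∀ k j, x j k = -x k j) (hdiag : ∀ k, x k k = 0)
    (hrec : ∀ i, ∑ l ∈ range (2 * p + 1), x p l * Γ l i = 0) (h : GramWindow p x Γ) :
    GramWindow p (fun i j => x (i + 1) (j + 1)) (fun i j => Γ (i + 1) (j + 1)) := by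
  have hrec' : ∀ i, ∑ l ∈ range p, x p l * Γ l i +
      ∑ l ∈ range p, x p (p + l) * Γ (p + l) i + Γ (2 * p) i = 0 := by
    intro i
    have := hrec i
    rw [Finset.sum_range_succ, two_mul, Finset.sum_range_add, hx1, one_mul, ← two_mul] at this
    exact this
  have hmid : ∀ i < p, Γ p i = if i = 0 then 1 else 0 := by
    intro i hi
    have := h.dual 0 hp i hi
    rw [Finset.sum_eq_single 0] at this
    · have hx := hx1 0
      rw [zero_add] at hx
      rw [add_zero, hx, one_mul] at this
      rw [this]
      simp [eq_comm]
    · intro l _ hl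
      rw [hx0 _ _ (by omega), zero_mul]
    · simp [hp]
  have hlast : ∀ i < p, Γ (2 * p) (p + i) = if i = 0 then 1 else 0 := by
    intro i hi
    have h1 := hrec' (p + i)
    have h2 : ∑ l ∈ range p, x p (p + l) * Γ (p + l) (p + i) = 0 :=
      Finset.sum_eq_zero fun l hl => by
        rw [h.isotropic_right l (Finset.mem_range.1 hl) i hi, mul_zero]
    have h3 : ∑ l ∈ range p, x p l * Γ l (p + i) = -if i = 0 then 1 else 0 := by
      rw [← h.dual' i hi 0 hp, ← Finset.sum_neg_distrib]
      refine Finset.sum_congr rfl fun l _ => ?_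
      rw [hanti l p, hsym l, add_zero]
      ring
    rw [h2, h3] at h1
    linear_combination h1
  have hlast2 : Γ (2 * p) (2 * p) = 0 := by
    have h1 := hrec' (2 * p)
    have h2 : ∑ l ∈ range p, x p (p + l) * Γ (p + l) (2 * p) = 0 := by
      rw [Finset.sum_eq_single 0]
      · rw [add_zero, hdiag, zero_mul]
      · intro l hl hl0
        rw [hsym, hlast l (Finset.mem_range.1 hl), if_neg hl0, mul_zero]
      · simp [hp]
    have h3 : ∑ l ∈ range p, x p l * Γ l (2 * p) = 0 := by
      have h4 : ∀ l ∈ range p, x p l * Γ l (2 * p) =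
          ∑ i ∈ range p, x p (p + i) * (Γ (p + i) l * x l (p + 0)) := by
        intro l hl
        have h5 := hrec' l
        have h6 : ∑ k ∈ range p, x p k * Γ k l = 0 :=
          Finset.sum_eq_zero fun k hk => by
            rw [h.isotropic_left k (Finset.mem_range.1 hk) l (Finset.mem_range.1 hl), mul_zero]
        simp only [← mul_assoc]
        rw [← Finset.sum_mul, hsym l, add_zero, hanti l p]
        linear_combination x l p * (h6 - h5)
      rw [Finset.sum_congr rfl h4, Finset.sum_comm]
      refine Finset.sum_eq_zero fun i hi => ?_
      rw [← Finset.mul_sum, h.dual' i (Finset.mem_range.1 hi) 0 hp]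
      by_cases hi0 : i = 0
      · rw [hi0, add_zero, hdiag, zero_mul]
      · rw [if_neg hi0, mul_zero]
    linear_combination h1 - h2 - h3
  refine ⟨?_, ?_, ?_⟩
  · intro i hi j hj
    show Γ (i + 1) (j + 1) = 0
    rcases Nat.lt_or_ge (i + 1) p with hi' | hi'
    · rcases Nat.lt_or_ge (j + 1) p with hj' | hj'
      · exact h.isotropic_left _ hi' _ hj'
      · rw [hsym, show j + 1 = p by omega, hmid _ hi', if_neg (by omega)]
    · rcases Nat.lt_or_ge (j + 1) p with hj' | hj'
      · rw [show i + 1 = p by omega, hmid _ hj', if_neg (by omega)]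
      · rw [show i + 1 = p + 0 by omega, show j + 1 = p + 0 by omega]
        exact h.isotropic_right 0 hp 0 hp
  · intro i hi j hj
    show Γ (p + i + 1) (p + j + 1) = 0
    rcases Nat.lt_or_ge (i + 1) p with hi' | hi'
    · rcases Nat.lt_or_ge (j + 1) p with hj' | hj'
      · exact h.isotropic_right _ hi' _ hj'
      · rw [hsym, show p + j + 1 = 2 * p by omega, add_assoc, hlast _ hi', if_neg (by omega)]
    · rcases Nat.lt_or_ge (j + 1) p with hj' | hj'
      · rw [show p + i + 1 = 2 * p by omega, add_assoc, hlast _ hj', if_neg (by omega)]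
      · rw [show p + i + 1 = 2 * p by omega, show p + j + 1 = 2 * p by omega, hlast2]
  · intro i hi j hj
    show ∑ l ∈ range p, x (i + 1) (p + l + 1) * Γ (p + l + 1) (j + 1) = _
    rcases Nat.lt_or_ge (j + 1) p with hj' | hj'
    · have hs : ∑ l ∈ range p, x (i + 1) (p + l + 1) * Γ (p + l + 1) (j + 1) =
          ∑ l ∈ range p, x (i + 1) (p + l) * Γ (p + l) (j + 1) +
            x (i + 1) (2 * p) * Γ (2 * p) (j + 1) := by
        have h1 := Finset.sum_range_succ (fun l => x (i + 1) (p + l) * Γ (p + l) (j + 1)) p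
        rw [Finset.sum_range_succ', add_zero, hmid _ hj', if_neg (by omega), mul_zero, add_zero,
          ← two_mul] at h1
        exact h1
      rw [hs]
      rcases Nat.lt_or_ge (i + 1) p with hi' | hi'
      · rw [h.dual _ hi' _ hj', hx0 _ _ (by omega), zero_mul, add_zero]
        simp
      · have h1 := hrec' (j + 1)
        have h2 : ∑ l ∈ range p, x p l * Γ l (j + 1) = 0 :=
          Finset.sum_eq_zero fun l hl => by
            rw [h.isotropic_left l (Finset.mem_range.1 hl) _ hj', mul_zero]
        have h3 := hx1 p
        rw [← two_mul] at h3
        rw [show i + 1 = p by omega, h3, if_neg (by omega)]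
        linear_combination h1 - h2
    · rw [Finset.sum_eq_single (p - 1)]
      · have h0 := hlast 0 hp
        rw [add_zero, if_pos rfl] at h0
        rw [show p + (p - 1) + 1 = 2 * p by omega, show j + 1 = p by omega, h0, mul_one]
        by_cases hij : i = j
        · have h3 := hx1 p
          rw [← two_mul] at h3
          rw [if_pos hij, show i + 1 = p by omega, h3]
        · rw [if_neg hij, hx0 _ _ (by omega)]
      · intro l hl hl'
        rw [Finset.mem_range] at hl
        have := h.isotropic_right (l + 1) (by omega) 0 hp
        rw [show j + 1 = p + 0 by omega, add_assoc, this, mul_zero]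
      · simp [hp]

lemma GramWindow.shift {p : ℕ} (hp : 0 < p) {x Γ : ℕ → ℕ → K} (hsym : ∀ i j, Γ i j = Γ j i)
    (hx0 : ∀ k j, k + p < j → x k j = 0) (hx1 : ∀ k, x k (k + p) = 1)
    (hanti : ∀ k j, x j k = -x k j) (hdiag : ∀ k, x k k = 0)
    (hrec : ∀ k i, ∑ l ∈ range (2 * p + 1), x (k + p) (k + l) * Γ (k + l) i = 0)
    (h : GramWindow p x Γ) (k : ℕ) :
    GramWindow p (fun i j => x (k + i) (k + j)) (fun i j => Γ (k + i) (k + j)) := by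
  induction k with
  | zero => simpa using h
  | succ k ih =>
    have := ih.succ hp (fun i j => hsym _ _) (fun i j hij => hx0 _ _ (by omega))
      (fun i => by simpa [add_assoc] using hx1 (k + i)) (fun i j => hanti _ _)
      (fun i => hdiag _) (fun i => hrec k (k + i))
    simpa only [add_assoc, add_comm, add_left_comm] using this

lemma GramWindow.gram_eq {p : ℕ} (hp : 0 < p) {x Γ : ℕ → ℕ → K}
    (hx0 : ∀ j, p < j → x 0 j = 0) (hx1 : x 0 p = 1) (h : GramWindow p x Γ) : Γ p 0 = 1 := by
  have := h.dual 0 hp 0 hp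
  rw [Finset.sum_eq_single 0] at this
  · simpa [hx1] using this
  · intro l _ hl
    rw [hx0 _ (by omega), zero_mul]
  · simp [hp]

open Matrix in
/-- The lower right block of an orthogonal matrix of determinant `-1` for the hyperbolic form
is singular. -/
lemma det_toBlocks₂₂_eq_zero {ι : Type*} [Fintype ι] [DecidableEq ι]
    (h2 : ∀ x : K, 2 * x = 0 → x = 0) (g : Matrix (ι ⊕ ι) (ι ⊕ ι) K)
    (hg : gᵀ * fromBlocks 0 1 1 0 * g = fromBlocks 0 1 1 0) (hdet : g.det = -1) :
    g.toBlocks₂₂.det = 0 := by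
  obtain ⟨a, b, c, d, rfl⟩ : ∃ a b c d, g = fromBlocks a b c d :=
    ⟨_, _, _, _, (fromBlocks_toBlocks g).symm⟩
  have h1 : fromBlocks dᵀ bᵀ cᵀ aᵀ * fromBlocks a b c d = 1 := by
    have := congrArg (fun A => fromBlocks 0 1 1 0 * A) hg
    simpa [fromBlocks_transpose, fromBlocks_multiply] using this
  have h3 := mul_eq_one_comm.1 h1
  rw [fromBlocks_multiply, ← fromBlocks_one, fromBlocks_inj] at h3
  have h4 : fromBlocks a b c d * fromBlocks dᵀ 0 cᵀ 1 = fromBlocks 1 b 0 d := by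
    rw [fromBlocks_multiply, h3.1, h3.2.2.1]
    simp
  have h5 := congrArg Matrix.det h4
  rw [det_mul, det_fromBlocks_zero₁₂, det_fromBlocks_zero₂₁, hdet, det_transpose, det_one,
    mul_one, one_mul] at h5
  rw [toBlocks_fromBlocks₂₂]
  apply h2
  linear_combination -h5

open Matrix in
/-- The reflection in a vector of norm `-2`. -/
lemma exists_reflection {ι : Type*} [Fintype ι] [DecidableEq ι] {J : Matrix ι ι K} (hJ : Jᵀ = J)
    (v : ι → K) (hv : v ⬝ᵥ J *ᵥ v = -2) :
    ∃ R : Matrix ι ι K, Rᵀ * J * R = J ∧ R.det = -1 ∧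
      ∀ x, R *ᵥ x = x + (v ⬝ᵥ J *ᵥ x) • v := by
  have hvJ : v ᵥ* J = J *ᵥ v := by
    conv_rhs => rw [← hJ, mulVec_transpose]
  refine ⟨1 + vecMulVec v (J *ᵥ v), ?_, ?_, ?_⟩
  · rw [transpose_add, transpose_one, transpose_vecMulVec]
    simp only [add_mul, mul_add, one_mul, mul_one, mul_vecMulVec, vecMulVec_mul, hvJ,
      vecMulVec_mulVec]
    rw [dotProduct_comm, hv]
    ext i j
    simp [vecMulVec_apply]
    ring
  · rw [vecMulVec_eq Unit, det_one_add_replicateCol_mul_replicateRow, dotProduct_comm, hv]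
    ring
  · intro x
    rw [add_mulVec, one_mulVec, vecMulVec_mulVec, ← hvJ, ← dotProduct_mulVec]
    simp

open Matrix in
lemma exists_orthogonal_shift {ι : Type*} [Fintype ι] [DecidableEq ι] {J : Matrix ι ι K}
    (hJ : Jᵀ = J) {n : ℕ} (V : ℕ → ι → K)
    (hV0 : ∀ k, ∀ i < n + 1, ∀ j < n + 1, V (k + i) ⬝ᵥ J *ᵥ V (k + j) = 0)
    (hV1 : ∀ k, V (k + (n + 1)) ⬝ᵥ J *ᵥ V k = 1) (N k : ℕ) :
    ∃ (g : Matrix ι ι K) (τ : Equiv.Perm (Fin (n + 1))), gᵀ * J * g = J ∧ g.det = (-1) ^ k ∧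
      ∀ i : Fin (n + 1), V (N + k + (i : ℕ)) = g *ᵥ V (N + (τ i : ℕ)) := by
  have hsym : ∀ x y : ι → K, x ⬝ᵥ J *ᵥ y = y ⬝ᵥ J *ᵥ x := by
    intro x y
    rw [dotProduct_mulVec, dotProduct_comm, ← mulVec_transpose, hJ]
  induction k with
  | zero => exact ⟨1, 1, by simp, by simp, by simp⟩
  | succ k ih =>
    obtain ⟨g, τ, hg, hdet, hgV⟩ := ih
    have e00 := hV0 (N + k) 0 (by omega) 0 (by omega)
    have e11 := hV0 (N + k + (n + 1)) 0 (by omega) 0 (by omega)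
    have e10 := hV1 (N + k)
    have e01 := e10
    rw [hsym] at e01
    simp only [add_zero] at e00 e11
    obtain ⟨R, hR, hRdet, hRx⟩ := exists_reflection hJ (V (N + k) - V (N + k + (n + 1))) (by
      simp only [mulVec_sub, dotProduct_sub, sub_dotProduct, e00, e11, e10, e01]
      ring)
    refine ⟨R * g, (finRotate (n + 1)).trans τ, ?_, ?_, ?_⟩
    · calc (R * g)ᵀ * J * (R * g) = gᵀ * (Rᵀ * J * R) * g := by
            simp only [transpose_mul, Matrix.mul_assoc]
        _ = J := by rw [hR, hg]
    · rw [det_mul, hRdet, hdet, pow_succ]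
      ring
    · intro i
      rw [← mulVec_mulVec, Equiv.trans_apply, ← hgV, hRx]
      rcases Nat.lt_or_ge (i : ℕ) n with hi | hi
      · have hrot : ((finRotate (n + 1) i : Fin (n + 1)) : ℕ) = i + 1 := by
          have := finRotate_of_lt hi
          exact congrArg Fin.val this
        have e1 := hV0 (N + k) 0 (by omega) (i + 1) (by omega)
        have e2 := hV0 (N + k + 1) n (by omega) i (by omega)
        rw [add_zero] at e1
        rw [show N + k + 1 + n = N + k + (n + 1) by ring,
          show N + k + 1 + (i : ℕ) = N + k + (i + 1) by ring] at e2
        rw [hrot, sub_dotProduct, e1, e2, sub_zero, zero_smul, add_zero]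
        congr 1
        ring
      · have hi' : i = Fin.last n := Fin.ext (by simp; omega)
        rw [hi', finRotate_last, Fin.val_zero, add_zero, sub_dotProduct, e00, e10, Fin.val_last,
          show N + (k + 1) + n = N + k + (n + 1) by ring]
        simp

open Matrix in
/-- Two windows of `n + 1` consecutive vectors of a sequence obeying an antisymmetric recurrence of
order `2n + 2`, separated by a gap of odd length, are linearly dependent. -/
lemma det_gap_eq_zero {n : ℕ} (h2 : ∀ x : K, 2 * x = 0 → x = 0) {x : ℕ → ℕ → K}
    (hx0 : ∀ k j, k + (n + 1) < j → x k j = 0) (hx1 : ∀ k, x k (k + (n + 1)) = 1)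
    (hanti : ∀ k j, x j k = -x k j) (W : ℕ → Fin (n + 1) ⊕ Fin (n + 1) → K)
    (hrec : ∀ k, ∑ l ∈ range (2 * (n + 1) + 1), x (k + (n + 1)) (k + l) • W (k + l) = 0)
    (hunit : IsUnit (Matrix.of fun r c =>
      W (Sum.elim (fun i : Fin (n + 1) => (i : ℕ)) (fun i : Fin (n + 1) => n + 1 + i) c) r).det)
    {m : ℕ} (hm : Odd m) :
    (Matrix.of fun r c =>
      W (Sum.elim (fun i : Fin (n + 1) => (i : ℕ)) (fun i : Fin (n + 1) => n + 1 + m + i) c) r).det = 0 := by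
  have hdiag : ∀ k, x k k = 0 := fun k => h2 _ (by linear_combination hanti k k)
  set M : Matrix (Fin (n + 1) ⊕ Fin (n + 1)) (Fin (n + 1) ⊕ Fin (n + 1)) K := Matrix.of fun r c =>
    W (Sum.elim (fun i : Fin (n + 1) => (i : ℕ)) (fun i : Fin (n + 1) => n + 1 + i) c) r with hM
  let b : Matrix (Fin (n + 1)) (Fin (n + 1)) K := Matrix.of fun k j => x k (n + 1 + j)
  have hb : b.det = 1 := by
    rw [det_of_isLowerTriangular b]
    · refine Finset.prod_eq_one fun i _ => ?_
      simpa [b, add_comm] using hx1 i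
    · intro i j hij
      have hij' : i < j := hij
      exact hx0 _ _ (by have : (i : ℕ) < j := hij'; omega)
  have hbu : IsUnit bᵀ.det := by rw [det_transpose, hb]; exact isUnit_one
  let β := (bᵀ)⁻¹
  have hβ : bᵀ * β = 1 := mul_nonsing_inv _ hbu
  have hbβ : b * βᵀ = 1 := by
    have := congrArg Matrix.transpose (mul_eq_one_comm.1 hβ)
    simpa using this
  let T := M * fromBlocks 1 0 0 bᵀ
  have hT : IsUnit T.det := by
    simp only [T]
    rw [det_mul, det_fromBlocks_zero₂₁, det_one, one_mul]
    exact hunit.mul hbu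
  have hMT : T⁻¹ * M = fromBlocks 1 0 0 β := by
    have : M = T * fromBlocks 1 0 0 β := by
      simp only [T]
      rw [Matrix.mul_assoc, fromBlocks_multiply, hβ]
      simp
    conv_lhs => rw [this]
    rw [nonsing_inv_mul_cancel_left _ _ hT]
  let V : ℕ → Fin (n + 1) ⊕ Fin (n + 1) → K := fun i => T⁻¹ *ᵥ W i
  have hVpos : ∀ r c, V (Sum.elim (fun i : Fin (n + 1) => (i : ℕ)) (fun i : Fin (n + 1) => n + 1 + i) c) r =
      fromBlocks 1 0 0 β r c := fun r c => by
    rw [← hMT]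
    rfl
  have hVl (i : Fin (n + 1)) (r) : V i r = fromBlocks 1 0 0 β r (Sum.inl i) := hVpos r (Sum.inl i)
  have hVr (i : Fin (n + 1)) (r) : V (n + 1 + i) r = fromBlocks 1 0 0 β r (Sum.inr i) :=
    hVpos r (Sum.inr i)
  let J : Matrix (Fin (n + 1) ⊕ Fin (n + 1)) (Fin (n + 1) ⊕ Fin (n + 1)) K := fromBlocks 0 1 1 0
  have hJ : Jᵀ = J := by simp [J, fromBlocks_transpose]
  have hform : ∀ y z, y ⬝ᵥ J *ᵥ z =
      ∑ r, y (Sum.inl r) * z (Sum.inr r) + ∑ r, y (Sum.inr r) * z (Sum.inl r) := by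
    intro y z
    rw [dotProduct, Fintype.sum_sum_type]
    simp [J, fromBlocks_mulVec]
  let Γ : ℕ → ℕ → K := fun i j => V i ⬝ᵥ J *ᵥ V j
  have hsym : ∀ i j, Γ i j = Γ j i := by
    intro i j
    simp only [Γ]
    rw [dotProduct_mulVec, dotProduct_comm, ← mulVec_transpose, hJ]
  have hrecΓ : ∀ k i,
      ∑ l ∈ range (2 * (n + 1) + 1), x (k + (n + 1)) (k + l) * Γ (k + l) i = 0 := by
    intro k i
    have h1 := congrArg (fun y => (T⁻¹ *ᵥ y) ⬝ᵥ J *ᵥ V i) (hrec k)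
    simpa [mulVec_sum, mulVec_smul, sum_dotProduct, Γ, V] using h1
  have hwin : GramWindow (n + 1) x Γ := by
    refine ⟨fun i hi j hj => ?_, fun i hi j hj => ?_, fun i hi j hj => ?_⟩
    · have h1 := hVl ⟨i, hi⟩
      have h3 := hVl ⟨j, hj⟩
      simp only at h1 h3
      simp [Γ, hform, h1, h3]
    · have h1 := hVr ⟨i, hi⟩
      have h3 := hVr ⟨j, hj⟩
      simp only at h1 h3
      simp [Γ, hform, h1, h3]
    · have h3 := hVl ⟨j, hj⟩
      simp only at h3
      have h4 : ∀ l : Fin (n + 1), Γ (n + 1 + l) j = β ⟨j, hj⟩ l := by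
        intro l
        simp [Γ, hform, hVr l, h3, Matrix.one_apply]
      have h5 := congrArg (fun A : Matrix (Fin (n + 1)) (Fin (n + 1)) K => A ⟨i, hi⟩ ⟨j, hj⟩) hbβ
      simp only [Matrix.mul_apply, Matrix.one_apply, Matrix.transpose_apply, Fin.mk.injEq] at h5
      rw [← h5, Finset.sum_range]
      exact Finset.sum_congr rfl fun l _ => by rw [h4 l]; rfl
  have hshift := hwin.shift (Nat.succ_pos n) hsym hx0 hx1 hanti hdiag hrecΓ
  obtain ⟨g, τ, hg, hdet, hgV⟩ := exists_orthogonal_shift hJ V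
    (fun k i hi j hj => (hshift k).isotropic_left i hi j hj)
    (fun k => (hshift k).gram_eq (Nat.succ_pos n) (fun j hj => hx0 (k + 0) _ (by omega)) (hx1 k))
    (n + 1) m
  rw [hm.neg_one_pow] at hdet
  have hblock : (Matrix.of fun r c =>
      W (Sum.elim (fun i : Fin (n + 1) => (i : ℕ)) (fun i : Fin (n + 1) => n + 1 + m + i) c) r) =
      T * fromBlocks 1 (Matrix.of fun r i => V (n + 1 + m + (i : Fin (n + 1))) (Sum.inl r)) 0
        (g.toBlocks₂₂ * β.submatrix id τ) := by
    have h1 : T⁻¹ * (Matrix.of fun r c =>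
        W (Sum.elim (fun i : Fin (n + 1) => (i : ℕ)) (fun i : Fin (n + 1) => n + 1 + m + i) c) r) =
        fromBlocks 1 (Matrix.of fun r i => V (n + 1 + m + (i : Fin (n + 1))) (Sum.inl r)) 0
          (g.toBlocks₂₂ * β.submatrix id τ) := by
      ext r c
      change V (Sum.elim (fun i : Fin (n + 1) => (i : ℕ)) (fun i : Fin (n + 1) => n + 1 + m + i) c) r = _
      rcases c with c | c
      · rw [Sum.elim_inl, hVl]
        rcases r with r | r <;> simp
      · rcases r with r | r
        · rfl
        · rw [Sum.elim_inr, hgV, mulVec, dotProduct, Fintype.sum_sum_type]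
          simp [hVr, Matrix.mul_apply, toBlocks₂₂]
    rw [← h1, mul_nonsing_inv_cancel_left _ _ hT]
  rw [hblock, det_mul, det_fromBlocks_zero₂₁, det_mul g.toBlocks₂₂,
    det_toBlocks₂₂_eq_zero h2 g hg hdet, zero_mul, mul_zero, mul_zero]

/-- The coefficient of the factor `D - ε_i M_{x_i(⋅+n+1-i)}`. -/
def factorCoeff (n : ℕ) (Q : ℕ → ℂ → Kˣ) (i : ℕ) (v : ℂ) : K :=
  epsq n i * xq n Q i (v + (n : ℂ) + 1 - (i : ℂ))

lemma Ljq_eq_opProd (n : ℕ) (Q : ℕ → ℂ → Kˣ) :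
    Ljq n Q (2 * n + 2) =
      opProd ((List.range' 1 (2 * n + 2)).map fun i => shiftSub (factorCoeff n Q i)) := by
  rw [List.range'_eq_map_range, List.map_map, Ljq]
  congr 2
  funext r
  rw [show 2 * n + 3 - (2 * n + 2) + r = 1 + r by omega]
  rfl

lemma factorCoeff_left {n : ℕ} (Q : ℕ → ℂ → Kˣ) {a : ℕ} (ha : 1 ≤ a) (han : a ≤ n) (v : ℂ) :
    factorCoeff n Q a v = (Yq n Q a (v + n + 1 - a + a / 2) *
      (Yq n Q (a - 1) (v + n + 2 - a + ((a - 1 : ℕ) : ℂ) / 2))⁻¹ : Kˣ) := by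
  rw [factorCoeff, epsq, if_neg (by omega), one_mul, xq, if_pos han, zq, if_pos han]
  congr 4
  push_cast [ha]
  ring

lemma factorCoeff_right {n : ℕ} (Q : ℕ → ℂ → Kˣ) {a : ℕ} (ha : 1 ≤ a) (han : a ≤ n) (v : ℂ) :
    factorCoeff n Q (2 * n + 3 - a) v =
      (Yq n Q (a - 1) (v + ((a - 1 : ℕ) : ℂ) / 2) * (Yq n Q a (v + a / 2))⁻¹ : Kˣ) := by
  rw [factorCoeff, epsq, if_neg (by omega), one_mul, xq, if_neg (by omega), if_neg (by omega),
    if_neg (by omega), zq, if_neg (by omega), show 2 * n - (2 * n + 3 - a - 2) = a - 1 by omega,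
    show 2 * n + 1 - (2 * n + 3 - a - 2) = a by omega,
    show 2 * n + 3 - a - 2 = 2 * n + 1 - a by omega, Nat.cast_sub (by omega : a ≤ 2 * n + 3),
    Nat.cast_sub (by omega : a ≤ 2 * n + 1), Nat.cast_sub ha]
  push_cast
  congr 3
  · ring_nf
  · ring_nf

lemma xqmid_mul_xqmid {n : ℕ} (hn : n ≠ 0) (Q : ℕ → ℂ → Kˣ) (v : ℂ) :
    xqmid n Q v * xqmid n Q (v - 1) =
      (Yq n Q n (v + n / 2) * (Yq n Q n (v + 1 + n / 2))⁻¹ : Kˣ) := by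
  have h : ∀ u, xqmid n Q u = (Q n (u + (n : ℂ) / 2) * Q n (u + ((n : ℂ) + 4) / 2) *
      ((Q n (u + ((n : ℂ) + 2) / 2))⁻¹) ^ 2 : Kˣ) := fun u => by simp [xqmid]
  rw [h, h, ← Units.val_mul, Yq, Yq, if_neg hn, if_neg hn, if_pos rfl]
  congr 1
  rw [show v + ((n : ℂ) + 4) / 2 = v + 1 + n / 2 + 1 by ring,
    show v + ((n : ℂ) + 2) / 2 = v + n / 2 + 1 by ring,
    show v - 1 + (n : ℂ) / 2 = v + n / 2 - 1 by ring,
    show v - 1 + ((n : ℂ) + 4) / 2 = v + n / 2 + 1 by ring,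
    show v - 1 + ((n : ℂ) + 2) / 2 = v + n / 2 by ring,
    show v + 1 + (n : ℂ) / 2 - 1 = v + n / 2 by ring]
  generalize Q n (v + n / 2) = q₀
  generalize Q n (v + n / 2 + 1) = q₁
  generalize Q n (v + n / 2 - 1) = q₂
  generalize Q n (v + 1 + n / 2 + 1) = q₃
  rw [mul_inv, inv_inv]
  calc q₀ * q₃ * q₁⁻¹ ^ 2 * (q₂ * q₁ * q₀⁻¹ ^ 2)
      = (q₀ * q₀⁻¹) * (q₁ * q₁⁻¹) * (q₂ * q₁⁻¹ * (q₀⁻¹ * q₃)) := by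
        simp only [pow_two]
        ac_rfl
    _ = q₂ * q₁⁻¹ * (q₀⁻¹ * q₃) := by simp

/-- The full operator is, up to a shift, an antisymmetric difference operator. -/
lemma exists_antisymm_Ljq {n : ℕ} (hn : n ≠ 0) (Q : ℕ → ℂ → Kˣ) :
    ∃ e : ℤ → ℂ → K, (∀ j u, e (-j) u = -e j (u - j)) ∧
      (∀ j u, ((n : ℤ) + 1) < |j| → e j u = 0) ∧ (∀ u, e (n + 1) u = 1) ∧
      ∀ (f : ℂ → K) (u : ℂ), ∑ j ∈ Icc (-((n : ℤ) + 1)) (n + 1), e j u * f (u + j) =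
        Ljq n Q (2 * n + 2) f (u - n - 1) := by
  obtain ⟨e, h₁, h₂, h₃, h₄⟩ := exists_antisymm_coeff (κ := factorCoeff n Q)
    (H := fun a v => Yq n Q a (v + a / 2)) (μ := xqmid n Q)
    (fun a ha han v => factorCoeff_left Q ha han v)
    (fun a ha han v => factorCoeff_right Q ha han v)
    (fun v => by
      rw [factorCoeff, epsq, if_pos (Or.inl rfl), xq, if_neg (by omega), if_pos rfl]
      push_cast
      rw [show v + n + 1 - ((n : ℂ) + 1) = v by ring]
      ring)
    (fun v => by
      rw [factorCoeff, epsq, if_pos (Or.inr rfl), xq, if_neg (by omega), if_neg (by omega),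
        if_pos rfl]
      push_cast
      rw [show v + n + 1 - ((n : ℂ) + 2) = v - 1 by ring]
      ring)
    (fun v => xqmid_mul_xqmid hn Q v) n le_rfl
  refine ⟨e, h₁, h₂, fun u => ?_, fun f u => ?_⟩
  · rw [h₃]
    simp [Yq]
  · rw [h₄, Ljq_eq_opProd]
    simp [Yq]

/-- For odd `m`, `ξ^{(n+1)}_m(u) = 0` (for the basis of solutions `w_1, …, w_N`
with `L_j(w_m) = 0` and invertible Casoratians, over a ring where `2` is a
non-zero-divisor). -/
theorem statement14 {K : Type*} [CommRing K] (n : ℕ) (hn : 2 ≤ n)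
    (h2 : ∀ x : K, 2 * x = 0 → x = 0) (Q : ℕ → ℂ → Kˣ)
    (w : ℕ → ℂ → K)
    (hw : ∀ m j : ℕ, 1 ≤ m → m ≤ j → j ≤ 2 * n + 2 → Ljq n Q j (w m) = 0)
    (hunit : ∀ (j : ℕ) (u : ℂ), 1 ≤ j → j ≤ 2 * n + 2 → IsUnit (casq w j u))
    (m : ℕ) (hm : Odd m) (u : ℂ) :
    xiq n w (n + 1) m u = 0 := by
  obtain ⟨e, hanti, hsupp, htop, hact⟩ := exists_antisymm_Ljq (by omega : n ≠ 0) Q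
  let σ : Fin (n + 1) ⊕ Fin (n + 1) ≃ Fin (2 * n + 2) :=
    finSumFinEquiv.trans (finCongr (by omega))
  have hσl : ∀ i : Fin (n + 1), (σ (Sum.inl i) : ℕ) = i := fun i => by simp [σ]
  have hσr : ∀ i : Fin (n + 1), (σ (Sum.inr i) : ℕ) = n + 1 + i := fun i => by
    simp [σ, add_comm]
  have hrec : ∀ k r : ℕ, r < 2 * n + 2 → ∑ l ∈ range (2 * (n + 1) + 1),
      e (((k + l : ℕ) : ℤ) - ((k + (n + 1) : ℕ) : ℤ)) (u + ((k + (n + 1) : ℕ) : ℂ)) *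
        w (r + 1) (u + ((k + l : ℕ) : ℂ)) = 0 := by
    intro k r hr
    have h := hact (w (r + 1)) (u + ((k + (n + 1) : ℕ) : ℂ))
    rw [hw (r + 1) (2 * n + 2) (by omega) (by omega) le_rfl, Pi.zero_apply] at h
    rw [← h]
    refine Finset.sum_bij (fun l _ => (l : ℤ) - (n + 1)) ?_ ?_ ?_ ?_
    · intro l hl
      rw [Finset.mem_range] at hl
      rw [Finset.mem_Icc]
      omega
    · intro a _ b _ hab
      omega
    · intro j hj
      rw [Finset.mem_Icc] at hj
      refine ⟨(j + (n + 1)).toNat, ?_, ?_⟩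
      · rw [Finset.mem_range]
        omega
      · omega
    · intro l _
      congr 2
      · push_cast
        ring
      · push_cast
        ring
  have key := det_gap_eq_zero (n := n) h2
    (x := fun k j => e ((j : ℤ) - k) (u + (k : ℂ)))
    (fun k j hkj => hsupp _ _ (lt_abs.2 (Or.inl (by omega))))
    (fun k => by
      rw [show ((k + (n + 1) : ℕ) : ℤ) - k = n + 1 by push_cast; ring]
      exact htop _)
    (fun k j => by
      rw [show (k : ℤ) - j = -((j : ℤ) - k) by ring, hanti]
      congr 2
      push_cast
      ring)
    (fun i r => w ((σ r : ℕ) + 1) (u + (i : ℂ)))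
    (fun k => by
      funext r
      simpa using hrec k (σ r) (σ r).2)
    (by
      have h := hunit (2 * n + 2) u (by omega) le_rfl
      rw [casq, ← Matrix.det_submatrix_equiv_self σ] at h
      convert h using 2
      ext r c
      rcases c with c | c
      · simp [hσl]
      · simp [hσr])
    hm
  rw [xiq, ← Matrix.det_submatrix_equiv_self σ, ← key]
  congr 1
  ext r c
  rcases c with c | c
  · simp [hσl, c.is_le]
  · simp [hσr, add_right_comm]
end
end

section
/- Casorati determinant solution of the C_n^{(1)} T-system: define T^{(0)}_m(v) = 1 and T^{(a)}_0(v) = 1 for all m, a, v; for 1 ≤ a ≤ n−1 and m ≥ 1 define T^{(a)}_m(u + (a+m−1)/2) = (−1)^m ξ^{(a)}_m(u)/ξ(u); and for m ≥ 1 define T^{(n)}_m(u + (n+2m)/2) = (−1)^m ∏_{j=1}^{m} ξ^{(n)}_{2j−1}(u+1)/ξ^{(n)}_{2j−2}(u+1). Then for all m ≥ 1 and u ∈ ℂ the T-system relations hold: (t1) T^{(a)}_m(u−1/2)·T^{(a)}_m(u+1/2) = T^{(a)}_{m+1}(u)·T^{(a)}_{m−1}(u) + T^{(a−1)}_m(u)·T^{(a+1)}_m(u)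 for 1 ≤ a ≤ n−2; (t2) T^{(n−1)}_{2m}(u−1/2)·T^{(n−1)}_{2m}(u+1/2) = T^{(n−1)}_{2m+1}(u)·T^{(n−1)}_{2m−1}(u) + T^{(n−2)}_{2m}(u)·T^{(n)}_m(u−1/2)·T^{(n)}_m(u+1/2); (t3) T^{(n−1)}_{2m+1}(u−1/2)·T^{(n−1)}_{2m+1}(u+1/2) = T^{(n−1)}_{2m+2}(u)·T^{(n−1)}_{2m}(u) + T^{(n−2)}_{2m+1}(u)·T^{(n)}_m(u)·T^{(n)}_{m+1}(u) (also for m = 0); (t4) T^{(n)}_m(u−1)·T^{(n)}_m(u+1) = T^{(n)}_{m+1}(u)·T^{(n)}_{m−1}(u) + T^{(n−1)}_{2m}(u). -/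
attribute [local instance 10] Classical.propDecidable

noncomputable section

open Finset

variable {K : Type*} [CommRing K]

/-- the Casorati determinant solution: `T^{(0)}_m = T^{(a)}_0 = 1`,
`T^{(a)}_m(u+(a+m-1)/2) = (-1)^m ξ^{(a)}_m(u)/ξ(u)` for `1 ≤ a ≤ n-1`, and
`T^{(n)}_m(u+(n+2m)/2) = (-1)^m ∏_{j=1}^m ξ^{(n)}_{2j-1}(u+1)/ξ^{(n)}_{2j-2}(u+1)`. -/
def Tsolq (n : ℕ) {F : Type*} [Field F] (w : ℕ → ℂ → F) (a m : ℕ) (v : ℂ) : F :=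
  if m = 0 then 1
  else if a = 0 then 1
  else if a ≤ n - 1 then
    (-1 : F) ^ m * xiq n w a m (v - ((a : ℂ) + (m : ℂ) - 1) / 2) /
      xiq n w a 0 (v - ((a : ℂ) + (m : ℂ) - 1) / 2)
  else if a = n then
    (-1 : F) ^ m * ∏ j ∈ Finset.range m,
      (xiq n w n (2 * j + 1) (v - ((n : ℂ) + 2 * (m : ℂ)) / 2 + 1) /
        xiq n w n (2 * j) (v - ((n : ℂ) + 2 * (m : ℂ)) / 2 + 1))
  else 0

section Plucker

open Matrix

/-- The three-term Plücker relation for the minors obtained from `A` by replacing the columns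
`i` and `j` with the vectors `x` and `y`. -/
theorem det_mul_det_updateCol_updateCol {ι : Type*} [Fintype ι] [DecidableEq ι]
    (A : Matrix ι ι K) {i j : ι} (hij : i ≠ j) (x y : ι → K) :
    A.det * ((A.updateCol i x).updateCol j y).det =
      (A.updateCol i x).det * (A.updateCol j y).det -
        (A.updateCol j x).det * (A.updateCol i y).det := by
  have hcomm (z : ι → K) : (A.updateCol i z).updateCol j y = (A.updateCol j y).updateCol i z := by
    ext r s
    simp only [updateCol_apply]
    split_ifs with h1 h2 <;> first | rfl | exact absurd (h2.symm.trans h1) hij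
  have hexp : A.det • x = ∑ k, (A.updateCol k x).det • fun r => A r k := by
    rw [← mulVec_cramer]
    ext r
    simp [mulVec, dotProduct, cramer_apply, mul_comm]
  have hsum : A.det * ((A.updateCol i x).updateCol j y).det =
      ∑ k, (A.updateCol k x).det * ((A.updateCol j y).updateCol i fun r => A r k).det := by
    rw [hcomm, ← cramer_apply, ← smul_eq_mul, ← Pi.smul_apply, ← map_smul, hexp, map_sum]
    simp [cramer_apply]
  have hself : ((A.updateCol j y).updateCol i fun r => A r i) = A.updateCol j y := by
    ext r s
    by_cases h : s = i
    · subst h; simp [hij]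
    · simp [h]
  have hswap : ((A.updateCol j y).updateCol i fun r => A r j).det = -(A.updateCol i y).det := by
    have hperm : (A.updateCol j y).updateCol i (fun r => A r j) =
        (A.updateCol i y).submatrix id (Equiv.swap i j) := by
      ext r s
      by_cases hi : s = i
      · subst hi; simp [hij.symm]
      by_cases hj : s = j
      · subst hj; simp [hij.symm]
      · simp [hi, hj, Equiv.swap_apply_of_ne_of_ne hi hj]
    rw [hperm, det_permute', Equiv.Perm.sign_swap hij]
    simp
  rw [hsum, Fintype.sum_eq_add i j hij, hself, hswap]
  · ring
  · rintro k ⟨hki, hkj⟩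
    refine mul_eq_zero_of_right _ (det_zero_of_column_eq hki.symm fun r => ?_)
    simp [hki, hkj]

theorem val_cycleIcc {N : ℕ} {i j : Fin N} (hij : i ≤ j) (k : Fin N) :
    (Fin.cycleIcc i j k : ℕ) =
      if (k : ℕ) < i ∨ (j : ℕ) < k then (k : ℕ) else if k = j then (i : ℕ) else (k : ℕ) + 1 := by
  have : NeZero N := ⟨by have := k.isLt; omega⟩
  split_ifs with h1 h2
  · rcases h1 with h | h
    · rw [Fin.cycleIcc_of_lt h]
    · rw [Fin.cycleIcc_of_gt h]
  · rw [h2, Fin.cycleIcc_of_last hij]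
  · have hkj : k < j := lt_of_le_of_ne (by simp only [Fin.le_def]; omega) h2
    rw [Fin.cycleIcc_of_ge_of_lt (by simp only [Fin.le_def]; omega) hkj]
    exact Fin.val_add_one_of_lt' (by have := j.isLt; simp only [Fin.lt_def] at hkj; omega)

/-- The minor of the columns `v (c 0), …, v (c (N - 1))`. -/
def colDet {N : ℕ} (v : ℕ → Fin N → K) (c : Fin N → ℕ) : K :=
  det (of fun j r => v (c r) j)

theorem colDet_plucker {N : ℕ} (v : ℕ → Fin N → K) (c : Fin N → ℕ) {i j : Fin N} (hij : i ≠ j)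
    (x y : ℕ) :
    colDet v c * colDet v (Function.update (Function.update c i x) j y) =
      colDet v (Function.update c i x) * colDet v (Function.update c j y) -
        colDet v (Function.update c j x) * colDet v (Function.update c i y) := by
  have hupd (c : Fin N → ℕ) (k : Fin N) (z : ℕ) : colDet v (Function.update c k z) =
      ((of fun j r => v (c r) j).updateCol k (v z)).det := by
    unfold colDet
    congr 1
    ext r s
    by_cases h : s = k
    · subst h; simp
    · simp [h]
  have hupd₂ : colDet v (Function.update (Function.update c i x) j y) =
      (((of fun j r => v (c r) j).updateCol i (v x)).updateCol j (v y)).det := by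
    rw [hupd]
    congr 2
    ext r s
    by_cases h : s = i
    · subst h; simp
    · simp [h]
  rw [hupd₂, hupd, hupd, hupd, hupd]
  exact det_mul_det_updateCol_updateCol _ hij _ _

theorem colDet_comp_cycleIcc {N : ℕ} (v : ℕ → Fin N → K) (c : Fin N → ℕ) {i j : Fin N}
    (hij : i ≤ j) :
    colDet v c = (-1) ^ ((j : ℕ) - i) * colDet v (c ∘ Fin.cycleIcc i j) := by
  have h : colDet v (c ∘ Fin.cycleIcc i j) = (-1) ^ ((j : ℕ) - i) * colDet v c := by
    refine (det_permute' (Fin.cycleIcc i j) (of fun j r => v (c r) j)).trans ?_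
    rw [Fin.sign_cycleIcc_of_le hij]
    simp [colDet]
  rw [h, ← mul_assoc, ← mul_pow]
  simp

/-- The column indices `s, …, s + a - 1, s + a + m, s + a + m + 1, …`: a gap of length `m`
after `a` consecutive indices. -/
def gapSeq (N a m s : ℕ) (r : Fin N) : ℕ :=
  s + if (r : ℕ) < a then (r : ℕ) else r + m

/-- The discrete Hirota equation for minors whose columns have a single gap. -/
theorem colDet_gapSeq {N : ℕ} (v : ℕ → Fin N → K) {a : ℕ} (ha : a + 1 < N) (m : ℕ) :
    colDet v (gapSeq N (a + 1) (m + 1) 0) * colDet v (gapSeq N (a + 1) (m + 1) 1) =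
      colDet v (gapSeq N (a + 1) (m + 2) 0) * colDet v (gapSeq N (a + 1) m 1) +
        colDet v (gapSeq N a (m + 1) 1) * colDet v (gapSeq N (a + 2) (m + 1) 0) := by
  set c := gapSeq N (a + 1) (m + 1) 0 with hc
  let z : Fin N := ⟨0, by omega⟩
  let f : Fin N := ⟨a, by omega⟩
  let i : Fin N := ⟨a + 1, ha⟩
  let l : Fin N := ⟨N - 1, by omega⟩
  have hzi : z ≠ i := by simp [z, i]
  have hzf : z ≤ f := by simp [z, f, Fin.le_def]
  have hil : i ≤ l := by simp only [i, l, Fin.le_def]; omega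
  have hzl : z ≤ l := by simp [z, l, Fin.le_def]
  have key := colDet_plucker v c hzi (a + 1) (N + m + 1)
  have e₁ : colDet v (Function.update c z (a + 1)) =
      (-1) ^ a * colDet v (gapSeq N (a + 1) m 1) := by
    rw [colDet_comp_cycleIcc v _ hzf]
    congr 2
    funext r
    have hr := val_cycleIcc hzf r
    simp only [Function.comp_apply, Function.update_apply, hc, gapSeq, Fin.ext_iff, z, f] at hr ⊢
    split_ifs at hr ⊢ <;> omega
  have e₂ : colDet v (Function.update c i (N + m + 1)) =
      (-1) ^ (N - 1 - (a + 1)) * colDet v (gapSeq N (a + 1) (m + 2) 0) := by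
    rw [colDet_comp_cycleIcc v _ hil]
    congr 2
    funext r
    have hr := val_cycleIcc hil r
    simp only [Function.comp_apply, Function.update_apply, hc, gapSeq, Fin.ext_iff, i, l] at hr ⊢
    split_ifs at hr ⊢ <;> omega
  have e₃ : colDet v (Function.update c i (a + 1)) =
      colDet v (gapSeq N (a + 2) (m + 1) 0) := by
    congr 1
    funext r
    simp only [Function.update_apply, hc, gapSeq, Fin.ext_iff, i]
    split_ifs <;> omega
  have e₄ : colDet v (Function.update c z (N + m + 1)) =
      (-1) ^ (N - 1) * colDet v (gapSeq N a (m + 1) 1) := by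
    rw [colDet_comp_cycleIcc v _ hzl]
    congr 2
    funext r
    have hr := val_cycleIcc hzl r
    simp only [Function.comp_apply, Function.update_apply, hc, gapSeq, Fin.ext_iff, z, l] at hr ⊢
    split_ifs at hr ⊢ <;> omega
  have e₅ : colDet v (Function.update (Function.update c z (a + 1)) i (N + m + 1)) =
      (-1) ^ a * ((-1) ^ (N - 1 - (a + 1)) * colDet v (gapSeq N (a + 1) (m + 1) 1)) := by
    rw [colDet_comp_cycleIcc v _ hzf, colDet_comp_cycleIcc v _ hil]
    congr 3
    funext r
    have hr := val_cycleIcc hil r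
    have hr' := val_cycleIcc hzf (Fin.cycleIcc i l r)
    simp only [Function.comp_apply, Function.update_apply, hc, gapSeq, Fin.ext_iff, z, f, i, l]
      at hr hr' ⊢
    split_ifs at hr hr' ⊢ <;> omega
  rw [e₁, e₂, e₃, e₄, e₅] at key
  have hsign : (-1 : K) ^ (N - 1) = -((-1) ^ a * (-1) ^ (N - 1 - (a + 1))) := by
    rw [← pow_add, show N - 1 = a + (N - 1 - (a + 1)) + 1 by omega, pow_succ]
    simp
  have hsq (k : ℕ) : (-1 : K) ^ k * (-1) ^ k = 1 := by
    rw [← mul_pow]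
    simp
  have h₁ := hsq a
  have h₂ := hsq (N - 1 - (a + 1))
  rw [hsign] at key
  generalize (-1 : K) ^ a = σ at *
  generalize (-1 : K) ^ (N - 1 - (a + 1)) = τ at *
  have h₃ : σ * τ * (σ * τ) = 1 := by linear_combination τ * τ * h₁ + h₂
  linear_combination σ * τ * key - (colDet v c * colDet v (gapSeq N (a + 1) (m + 1) 1) -
    colDet v (gapSeq N (a + 1) (m + 2) 0) * colDet v (gapSeq N (a + 1) m 1) -
    colDet v (gapSeq N a (m + 1) 1) * colDet v (gapSeq N (a + 2) (m + 1) 0)) * h₃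

theorem xiq_add_natCast (n : ℕ) (w : ℕ → ℂ → K) (a m s : ℕ) (u : ℂ) :
    xiq n w a m (u + s) =
      colDet (fun k (j : Fin (2 * n + 2)) => w ((j : ℕ) + 1) (u + (k : ℂ)))
        (gapSeq (2 * n + 2) a m s) := by
  simp only [xiq, colDet, gapSeq, Nat.cast_add, add_assoc]

/-- The bilinear relation among the determinants `ξ^{(a)}_m`. -/
theorem xiq_mul_xiq_add_one (n : ℕ) (w : ℕ → ℂ → K) {a : ℕ} (ha : a < 2 * n + 1) (m : ℕ) (u : ℂ) :
    xiq n w (a + 1) (m + 1) u * xiq n w (a + 1) (m + 1) (u + 1) =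
      xiq n w (a + 1) (m + 2) u * xiq n w (a + 1) m (u + 1) +
        xiq n w a (m + 1) (u + 1) * xiq n w (a + 2) (m + 1) u := by
  have h₀ (b k : ℕ) := xiq_add_natCast n w b k 0 u
  have h₁ (b k : ℕ) := xiq_add_natCast n w b k 1 u
  simp only [Nat.cast_zero, add_zero, Nat.cast_one] at h₀ h₁
  simp only [h₀, h₁]
  exact colDet_gapSeq _ (by omega) m

end Plucker

section Casorati

variable {F : Type*} [Field F] {n : ℕ} {w : ℕ → ℂ → F}

theorem xiq_gap_zero (n : ℕ) (w : ℕ → ℂ → F) (a : ℕ) (u : ℂ) :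
    xiq n w a 0 u = xiq n w 0 0 u := by
  simp [xiq]

theorem xiq_zero_eq_shift (n : ℕ) (w : ℕ → ℂ → F) (m : ℕ) (u : ℂ) :
    xiq n w 0 m u = xiq n w 0 0 (u + m) := by
  simp only [xiq, Nat.not_lt_zero, if_false, Nat.cast_add, add_zero]
  congr 3
  funext j r
  ring_nf

/-- The uniform expression `(-1)^m ξ^{(a)}_m(v - (a+m-1)/2) / ξ(v - (a+m-1)/2)`. -/
def casoratiT (n : ℕ) (w : ℕ → ℂ → F) (a m : ℕ) (v : ℂ) : F :=
  (-1) ^ m * xiq n w a m (v - ((a : ℂ) + m - 1) / 2) / xiq n w 0 0 (v - ((a : ℂ) + m - 1) / 2)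

/-- The product `∏_{j=1}^m ξ^{(n)}_{2j-1}(x) / ξ^{(n)}_{2j-2}(x)`. -/
def ratioProd (n : ℕ) (w : ℕ → ℂ → F) (m : ℕ) (x : ℂ) : F :=
  ∏ j ∈ Finset.range m, (xiq n w n (2 * j + 1) x / xiq n w n (2 * j) x)

theorem ratioProd_zero (n : ℕ) (w : ℕ → ℂ → F) (x : ℂ) : ratioProd n w 0 x = 1 := by
  simp [ratioProd]

theorem ratioProd_succ (n : ℕ) (w : ℕ → ℂ → F) (m : ℕ) (x : ℂ) :
    ratioProd n w (m + 1) x =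
      ratioProd n w m x * (xiq n w n (2 * m + 1) x / xiq n w n (2 * m) x) :=
  Finset.prod_range_succ _ _

theorem Tsolq_self (hn : 2 ≤ n) (m : ℕ) (v : ℂ) :
    Tsolq n w n m v = (-1) ^ m * ratioProd n w m (v - ((n : ℂ) + 2 * (m : ℂ)) / 2 + 1) := by
  unfold Tsolq ratioProd
  split_ifs with h₁ h₂ h₃
  · simp [h₁]
  · omega
  · omega
  · rfl
  · contradiction

theorem Tsolq_eq_casoratiT (hxi0 : ∀ u : ℂ, xiq n w 0 0 u ≠ 0)
    (hanti : ∀ u : ℂ, xiq n w 0 0 (u + 1) = -xiq n w 0 0 u) {a : ℕ} (ha : a < n) (m : ℕ) (v : ℂ) :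
    Tsolq n w a m v = casoratiT n w a m v := by
  have hshift (k : ℕ) (u : ℂ) : xiq n w 0 0 (u + k) = (-1) ^ k * xiq n w 0 0 u := by
    induction k with
    | zero => simp
    | succ k ih =>
      rw [Nat.cast_succ, ← add_assoc, hanti, ih, pow_succ]
      ring
  unfold Tsolq casoratiT
  split_ifs with h₁ h₂ h₃ h₄
  · subst h₁
    rw [xiq_gap_zero, pow_zero, one_mul, div_self (hxi0 _)]
  · subst h₂
    rw [xiq_zero_eq_shift, hshift, ← mul_assoc, ← mul_pow, mul_div_assoc, div_self (hxi0 _)]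
    simp
  · rw [xiq_gap_zero n w a]
  · omega
  · omega

theorem casoratiT_of_eq {a m : ℕ} {v x : ℂ} (h : v = x + ((a : ℂ) + m - 1) / 2) :
    casoratiT n w a m v = (-1) ^ m * xiq n w a m x / xiq n w 0 0 x := by
  rw [casoratiT, h, add_sub_cancel_right]

/-- The functions `casoratiT` satisfy the `T`-system of type `A`. -/
theorem casoratiT_mul_casoratiT (hanti : ∀ u : ℂ, xiq n w 0 0 (u + 1) = -xiq n w 0 0 u)
    {a : ℕ} (ha : a < 2 * n + 1) (m : ℕ) (u : ℂ) :
    casoratiT n w (a + 1) (m + 1) (u - 2⁻¹) * casoratiT n w (a + 1) (m + 1) (u + 2⁻¹) =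
      casoratiT n w (a + 1) (m + 2) u * casoratiT n w (a + 1) m u +
        casoratiT n w a (m + 1) u * casoratiT n w (a + 2) (m + 1) u := by
  obtain ⟨x, rfl⟩ : ∃ x : ℂ, u = x + ((a : ℂ) + m + 2) / 2 := ⟨u - ((a : ℂ) + m + 2) / 2, by ring⟩
  rw [casoratiT_of_eq (a := a + 1) (m := m + 1) (x := x) (by push_cast; ring),
    casoratiT_of_eq (a := a + 1) (m := m + 1) (x := x + 1) (by push_cast; ring),
    casoratiT_of_eq (a := a + 1) (m := m + 2) (x := x) (by push_cast; ring),
    casoratiT_of_eq (a := a + 1) (m := m) (x := x + 1) (by push_cast; ring),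
    casoratiT_of_eq (a := a) (m := m + 1) (x := x + 1) (by push_cast; ring),
    casoratiT_of_eq (a := a + 2) (m := m + 1) (x := x) (by push_cast; ring), hanti]
  simp only [div_neg]
  linear_combination
    (-((-1) ^ m * (-1) ^ m / (xiq n w 0 0 x * xiq n w 0 0 x))) * xiq_mul_xiq_add_one n w ha m x

theorem xiq_odd_mul_xiq_odd (hn : 1 ≤ n)
    (hodd : ∀ (k : ℕ) (u : ℂ), xiq n w (n + 1) (2 * k + 1) u = 0) (m : ℕ) (x : ℂ) :
    xiq n w n (2 * m + 1) x * xiq n w n (2 * m + 1) (x + 1) =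
      xiq n w n (2 * m + 2) x * xiq n w n (2 * m) (x + 1) := by
  have h := xiq_mul_xiq_add_one n w (a := n - 1) (by omega) (2 * m) x
  rw [show n - 1 + 1 = n by omega, show n - 1 + 2 = n + 1 by omega, hodd, mul_zero, add_zero] at h
  exact h

theorem ratioProd_mul_ratioProd_add_one (hn : 1 ≤ n)
    (hxi0 : ∀ u : ℂ, xiq n w 0 0 u ≠ 0) (hxin : ∀ (j : ℕ) (u : ℂ), xiq n w n (2 * j) u ≠ 0)
    (hodd : ∀ (k : ℕ) (u : ℂ), xiq n w (n + 1) (2 * k + 1) u = 0) (m : ℕ) (x : ℂ) :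
    ratioProd n w m x * ratioProd n w m (x + 1) = xiq n w n (2 * m) x / xiq n w 0 0 x := by
  induction m with
  | zero => rw [ratioProd_zero, ratioProd_zero, mul_zero, xiq_gap_zero, div_self (hxi0 _), one_mul]
  | succ m ih =>
    have h := xiq_odd_mul_xiq_odd hn hodd m x
    have h₁ := hxin m x
    have h₂ := hxin m (x + 1)
    have h₀ := hxi0 x
    rw [ratioProd_succ, ratioProd_succ, mul_mul_mul_comm, ih, div_mul_div_comm, h, mul_add, mul_one]
    field_simp

theorem xiq_middle_mul_xiq_middle
    (hrefl : ∀ (k : ℕ) (u : ℂ), xiq n w (n + 2) k u = (-1) ^ (k + 1) * xiq n w n k (u + 1))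
    (hanti : ∀ u : ℂ, xiq n w 0 0 (u + 1) = -xiq n w 0 0 u)
    (hodd : ∀ (k : ℕ) (u : ℂ), xiq n w (n + 1) (2 * k + 1) u = 0) (m : ℕ) (x : ℂ) :
    xiq n w (n + 1) (2 * m) x * xiq n w (n + 1) (2 * m) (x + 1) =
      -xiq n w n (2 * m) (x + 1) ^ 2 := by
  cases m with
  | zero =>
    simp only [mul_zero, xiq_gap_zero n w (n + 1), xiq_gap_zero n w n, hanti]
    ring
  | succ m =>
    have h := xiq_mul_xiq_add_one n w (a := n) (by omega) (2 * m + 1) x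
    rw [show 2 * m + 1 + 2 = 2 * (m + 1) + 1 by omega, hodd, hrefl,
      show 2 * m + 1 + 1 = 2 * (m + 1) by omega, pow_succ, pow_mul] at h
    rw [h]
    ring

theorem xiq_odd_sq
    (hrefl : ∀ (k : ℕ) (u : ℂ), xiq n w (n + 2) k u = (-1) ^ (k + 1) * xiq n w n k (u + 1))
    (hodd : ∀ (k : ℕ) (u : ℂ), xiq n w (n + 1) (2 * k + 1) u = 0) (m : ℕ) (x : ℂ) :
    xiq n w n (2 * m + 1) (x + 1) ^ 2 =
      -(xiq n w (n + 1) (2 * m + 2) x * xiq n w (n + 1) (2 * m) (x + 1)) := by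
  have h := xiq_mul_xiq_add_one n w (a := n) (by omega) (2 * m) x
  rw [hodd, hrefl, pow_succ, pow_succ, pow_mul] at h
  linear_combination -h

theorem xiq_middle_ne_zero
    (hrefl : ∀ (k : ℕ) (u : ℂ), xiq n w (n + 2) k u = (-1) ^ (k + 1) * xiq n w n k (u + 1))
    (hanti : ∀ u : ℂ, xiq n w 0 0 (u + 1) = -xiq n w 0 0 u)
    (hxin : ∀ (j : ℕ) (u : ℂ), xiq n w n (2 * j) u ≠ 0)
    (hodd : ∀ (k : ℕ) (u : ℂ), xiq n w (n + 1) (2 * k + 1) u = 0) (m : ℕ) (x : ℂ) :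
    xiq n w (n + 1) (2 * m) x ≠ 0 := by
  refine left_ne_zero_of_mul (b := xiq n w (n + 1) (2 * m) (x + 1)) ?_
  rw [xiq_middle_mul_xiq_middle hrefl hanti hodd]
  exact neg_ne_zero.mpr (pow_ne_zero _ (hxin _ _))

theorem ratioProd_sq
    (hrefl : ∀ (k : ℕ) (u : ℂ), xiq n w (n + 2) k u = (-1) ^ (k + 1) * xiq n w n k (u + 1))
    (hanti : ∀ u : ℂ, xiq n w 0 0 (u + 1) = -xiq n w 0 0 u)
    (hxi0 : ∀ u : ℂ, xiq n w 0 0 u ≠ 0) (hxin : ∀ (j : ℕ) (u : ℂ), xiq n w n (2 * j) u ≠ 0)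
    (hodd : ∀ (k : ℕ) (u : ℂ), xiq n w (n + 1) (2 * k + 1) u = 0) (m : ℕ) (x : ℂ) :
    ratioProd n w m (x + 1) ^ 2 = xiq n w (n + 1) (2 * m) x / xiq n w 0 0 x := by
  induction m with
  | zero => rw [ratioProd_zero, mul_zero, xiq_gap_zero, div_self (hxi0 _), one_pow]
  | succ m ih =>
    have h₁ := xiq_middle_ne_zero hrefl hanti hxin hodd m x
    have h₂ := xiq_middle_ne_zero hrefl hanti hxin hodd m (x + 1)
    have h₀ := hxi0 x
    have h₃ : xiq n w n (2 * m) (x + 1) ^ 2 =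
        -(xiq n w (n + 1) (2 * m) x * xiq n w (n + 1) (2 * m) (x + 1)) := by
      rw [xiq_middle_mul_xiq_middle hrefl hanti hodd, neg_neg]
    rw [ratioProd_succ, mul_pow, ih, div_pow, xiq_odd_sq hrefl hodd, h₃, mul_add, mul_one]
    field_simp

theorem ratioProd_mul_ratioProd_add_two (hn : 1 ≤ n)
    (hrefl : ∀ (k : ℕ) (u : ℂ), xiq n w (n + 2) k u = (-1) ^ (k + 1) * xiq n w n k (u + 1))
    (hanti : ∀ u : ℂ, xiq n w 0 0 (u + 1) = -xiq n w 0 0 u)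
    (hxi0 : ∀ u : ℂ, xiq n w 0 0 u ≠ 0) (hxin : ∀ (j : ℕ) (u : ℂ), xiq n w n (2 * j) u ≠ 0)
    (hodd : ∀ (k : ℕ) (u : ℂ), xiq n w (n + 1) (2 * k + 1) u = 0) (m : ℕ) (x : ℂ) :
    ratioProd n w (m + 1) x * ratioProd n w (m + 1) (x + 2) =
      ratioProd n w (m + 2) x * ratioProd n w m (x + 2) +
        xiq n w (n - 1) (2 * m + 2) (x + 1) / xiq n w 0 0 (x + 1) := by
  have hprod (k : ℕ) (y : ℂ) := ratioProd_mul_ratioProd_add_one hn hxi0 hxin hodd k y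
  have hP (k : ℕ) (y : ℂ) : ratioProd n w k y ≠ 0 :=
    left_ne_zero_of_mul (hprod k y ▸ div_ne_zero (hxin k y) (hxi0 y))
  have hC : xiq n w n (2 * m + 1) (x + 1) ≠ 0 := by
    refine left_ne_zero_of_mul (b := xiq n w n (2 * m + 1) (x + 1 + 1)) ?_
    rw [xiq_odd_mul_xiq_odd hn hodd]
    exact mul_ne_zero (hxin (m + 1) _) (hxin m _)
  have e₁ := hprod (m + 1) x
  have e₂ := hprod m (x + 1)
  have e₃ := ratioProd_sq hrefl hanti hxi0 hxin hodd (m + 1) x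
  have e₄ := ratioProd_succ n w m (x + 1)
  have e₅ := ratioProd_succ n w m (x + 2)
  have e₆ := ratioProd_succ n w (m + 1) x
  have e₇ := xiq_odd_mul_xiq_odd hn hodd m (x + 1)
  have e₈ := xiq_mul_xiq_add_one n w (a := n - 1) (by omega) (2 * m + 1) x
  have n₁ := hxin m (x + 1)
  have n₂ := hxin m (x + 2)
  have n₃ := hxin (m + 1) x
  have n₄ := hxi0 x
  have n₅ := hxi0 (x + 1)
  have n₆ := xiq_middle_ne_zero hrefl hanti hxin hodd (m + 1) x
  rw [show x + 1 + 1 = x + 2 by ring] at e₂ e₇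
  rw [show n - 1 + 1 = n by omega, show n - 1 + 2 = n + 1 by omega] at e₈
  simp only [mul_add, mul_one, add_assoc, Nat.reduceAdd] at e₁ e₂ e₃ e₄ e₅ e₆ e₇ e₈ n₃ n₆
  have hmid : ratioProd n w (m + 1) (x + 1) * ratioProd n w m (x + 1) =
      xiq n w (n + 1) (2 * m + 2) x * xiq n w n (2 * m) (x + 1) /
        (xiq n w 0 0 x * xiq n w n (2 * m + 1) (x + 1)) := by
    have : ratioProd n w m (x + 1) = ratioProd n w (m + 1) (x + 1) *
        (xiq n w n (2 * m) (x + 1) / xiq n w n (2 * m + 1) (x + 1)) := by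
      rw [e₄]
      field_simp
    rw [this, ← mul_assoc, ← pow_two, e₃, div_mul_div_comm]
  have hpre : ratioProd n w (m + 1) x * ratioProd n w m (x + 2) =
      xiq n w n (2 * m + 2) x * xiq n w n (2 * m + 1) (x + 1) /
        (xiq n w 0 0 (x + 1) * xiq n w (n + 1) (2 * m + 2) x) := by
    refine mul_right_cancel₀ (mul_ne_zero (hP (m + 1) (x + 1)) (hP m (x + 1))) ?_
    calc _ = (ratioProd n w (m + 1) x * ratioProd n w (m + 1) (x + 1)) *
          (ratioProd n w m (x + 1) * ratioProd n w m (x + 2)) := by ring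
      _ = _ := by
        rw [e₁, e₂, hmid]
        field_simp
  have hdiff : xiq n w n (2 * m + 1) (x + 2) / xiq n w n (2 * m) (x + 2) =
      xiq n w n (2 * m + 3) x / xiq n w n (2 * m + 2) x +
        xiq n w (n - 1) (2 * m + 2) (x + 1) * xiq n w (n + 1) (2 * m + 2) x /
          (xiq n w n (2 * m + 1) (x + 1) * xiq n w n (2 * m + 2) x) := by
    have : xiq n w n (2 * m + 1) (x + 2) / xiq n w n (2 * m) (x + 2) =
        xiq n w n (2 * m + 2) (x + 1) / xiq n w n (2 * m + 1) (x + 1) := by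
      rw [div_eq_div_iff n₂ hC, ← e₇, mul_comm]
    rw [this]
    field_simp
    linear_combination e₈
  calc _ = (ratioProd n w (m + 1) x * ratioProd n w m (x + 2)) *
        (xiq n w n (2 * m + 1) (x + 2) / xiq n w n (2 * m) (x + 2)) := by
        rw [e₅]
        ring
    _ = (ratioProd n w (m + 1) x * (xiq n w n (2 * m + 3) x / xiq n w n (2 * m + 2) x)) *
          ratioProd n w m (x + 2) + (ratioProd n w (m + 1) x * ratioProd n w m (x + 2)) *
        (xiq n w (n - 1) (2 * m + 2) (x + 1) * xiq n w (n + 1) (2 * m + 2) x /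
          (xiq n w n (2 * m + 1) (x + 1) * xiq n w n (2 * m + 2) x)) := by
        rw [hdiff]
        ring
    _ = _ := by
        rw [← e₆, hpre]
        congr 1
        field_simp

theorem Tsolq_self_mul_even (hn : 2 ≤ n)
    (hxi0 : ∀ u : ℂ, xiq n w 0 0 u ≠ 0) (hxin : ∀ (j : ℕ) (u : ℂ), xiq n w n (2 * j) u ≠ 0)
    (hodd : ∀ (k : ℕ) (u : ℂ), xiq n w (n + 1) (2 * k + 1) u = 0) (m : ℕ) (u : ℂ) :
    Tsolq n w n m (u - 2⁻¹) * Tsolq n w n m (u + 2⁻¹) = casoratiT n w n (2 * m) u := by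
  obtain ⟨x, rfl⟩ : ∃ x : ℂ, u = x + ((n : ℂ) + 2 * m - 1) / 2 :=
    ⟨u - ((n : ℂ) + 2 * m - 1) / 2, by ring⟩
  have h := ratioProd_mul_ratioProd_add_one (by omega) hxi0 hxin hodd m x
  rw [casoratiT_of_eq (x := x) (by push_cast; ring), Tsolq_self hn, Tsolq_self hn,
    show x + ((n : ℂ) + 2 * m - 1) / 2 - 2⁻¹ - ((n : ℂ) + 2 * m) / 2 + 1 = x by ring,
    show x + ((n : ℂ) + 2 * m - 1) / 2 + 2⁻¹ - ((n : ℂ) + 2 * m) / 2 + 1 = x + 1 by ring,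
    mul_mul_mul_comm, h, two_mul, pow_add, mul_div_assoc]

theorem Tsolq_self_mul_odd (hn : 2 ≤ n)
    (hxi0 : ∀ u : ℂ, xiq n w 0 0 u ≠ 0) (hxin : ∀ (j : ℕ) (u : ℂ), xiq n w n (2 * j) u ≠ 0)
    (hodd : ∀ (k : ℕ) (u : ℂ), xiq n w (n + 1) (2 * k + 1) u = 0) (m : ℕ) (u : ℂ) :
    Tsolq n w n m u * Tsolq n w n (m + 1) u = casoratiT n w n (2 * m + 1) u := by
  obtain ⟨x, rfl⟩ : ∃ x : ℂ, u = x + ((n : ℂ) + 2 * m) / 2 :=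
    ⟨u - ((n : ℂ) + 2 * m) / 2, by ring⟩
  have h := ratioProd_mul_ratioProd_add_one (by omega) hxi0 hxin hodd m x
  have h₀ := hxi0 x
  have h₁ := hxin m x
  rw [casoratiT_of_eq (x := x) (by push_cast; ring), Tsolq_self hn, Tsolq_self hn,
    show x + ((n : ℂ) + 2 * m) / 2 - ((n : ℂ) + 2 * m) / 2 + 1 = x + 1 by ring,
    show x + ((n : ℂ) + 2 * m) / 2 - ((n : ℂ) + 2 * (m + 1 : ℕ)) / 2 + 1 = x by push_cast; ring,
    ratioProd_succ]
  calc _ = (-1) ^ (2 * m + 1) * (ratioProd n w m x * ratioProd n w m (x + 1)) *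
        (xiq n w n (2 * m + 1) x / xiq n w n (2 * m) x) := by ring
    _ = _ := by
      rw [h]
      field_simp

theorem Tsolq_self_mul_self (hn : 2 ≤ n)
    (hrefl : ∀ (k : ℕ) (u : ℂ), xiq n w (n + 2) k u = (-1) ^ (k + 1) * xiq n w n k (u + 1))
    (hanti : ∀ u : ℂ, xiq n w 0 0 (u + 1) = -xiq n w 0 0 u)
    (hxi0 : ∀ u : ℂ, xiq n w 0 0 u ≠ 0) (hxin : ∀ (j : ℕ) (u : ℂ), xiq n w n (2 * j) u ≠ 0)
    (hodd : ∀ (k : ℕ) (u : ℂ), xiq n w (n + 1) (2 * k + 1) u = 0) (m : ℕ) (u : ℂ) :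
    Tsolq n w n (m + 1) (u - 1) * Tsolq n w n (m + 1) (u + 1) =
      Tsolq n w n (m + 2) u * Tsolq n w n m u + casoratiT n w (n - 1) (2 * m + 2) u := by
  obtain ⟨x, rfl⟩ : ∃ x : ℂ, u = x + ((n : ℂ) + 2 * m + 2) / 2 :=
    ⟨u - ((n : ℂ) + 2 * m + 2) / 2, by ring⟩
  have h := ratioProd_mul_ratioProd_add_two (by omega) hrefl hanti hxi0 hxin hodd m x
  have hsq : (-1 : F) ^ m * (-1) ^ m = 1 := by
    rw [← mul_pow]
    simp
  have hsq₂ : (-1 : F) ^ (2 * m + 2) = 1 := by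
    rw [show 2 * m + 2 = 2 * (m + 1) by ring, pow_mul]
    simp
  have hn₁ : ((n - 1 : ℕ) : ℂ) = n - 1 := by
    rw [Nat.cast_sub (by omega), Nat.cast_one]
  rw [casoratiT_of_eq (x := x + 1) (by rw [hn₁]; push_cast; ring), Tsolq_self hn, Tsolq_self hn,
    Tsolq_self hn, Tsolq_self hn, hsq₂, one_mul,
    show x + ((n : ℂ) + 2 * m + 2) / 2 - 1 - ((n : ℂ) + 2 * (m + 1 : ℕ)) / 2 + 1 = x by
      push_cast; ring,
    show x + ((n : ℂ) + 2 * m + 2) / 2 + 1 - ((n : ℂ) + 2 * (m + 1 : ℕ)) / 2 + 1 = x + 2 by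
      push_cast; ring,
    show x + ((n : ℂ) + 2 * m + 2) / 2 - ((n : ℂ) + 2 * (m + 2 : ℕ)) / 2 + 1 = x by
      push_cast; ring,
    show x + ((n : ℂ) + 2 * m + 2) / 2 - ((n : ℂ) + 2 * m) / 2 + 1 = x + 2 by ring,
    mul_mul_mul_comm, mul_mul_mul_comm, pow_succ, pow_succ, pow_succ]
  linear_combination h + (ratioProd n w (m + 1) x * ratioProd n w (m + 1) (x + 2) -
    ratioProd n w (m + 2) x * ratioProd n w m (x + 2)) * hsq

end Casorati

/-- Proposition 4.2: the Casorati determinants solve the `C^{(1)}_n` `T`-system. -/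
theorem statement16 {F : Type*} [Field F] (n : ℕ) (hn : 2 ≤ n)
    (w : ℕ → ℂ → F)
    (hxi0 : ∀ u : ℂ, xiq n w 0 0 u ≠ 0)
    (hxin : ∀ (j : ℕ) (u : ℂ), xiq n w n (2 * j) u ≠ 0)
    (hdual : ∀ (a m : ℕ) (u : ℂ), a ≤ 2 * n + 2 →
      xiq n w a m u =
        (-1 : F) ^ ((a : ℤ) - (n : ℤ) - 1 + (m : ℤ)) *
          xiq n w (2 * n + 2 - a) m (u + (a : ℂ) - (n : ℂ) - 1))
    (hodd : ∀ (k : ℕ) (u : ℂ), xiq n w (n + 1) (2 * k + 1) u = 0) :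
    (∀ (a m : ℕ), 1 ≤ a → a ≤ n - 2 → 1 ≤ m → ∀ u : ℂ,
      Tsolq n w a m (u - 2⁻¹) * Tsolq n w a m (u + 2⁻¹) =
        Tsolq n w a (m + 1) u * Tsolq n w a (m - 1) u +
          Tsolq n w (a - 1) m u * Tsolq n w (a + 1) m u) ∧
    (∀ m : ℕ, 1 ≤ m → ∀ u : ℂ,
      Tsolq n w (n - 1) (2 * m) (u - 2⁻¹) * Tsolq n w (n - 1) (2 * m) (u + 2⁻¹) =
        Tsolq n w (n - 1) (2 * m + 1) u * Tsolq n w (n - 1) (2 * m - 1) u +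
          Tsolq n w (n - 2) (2 * m) u * Tsolq n w n m (u - 2⁻¹) * Tsolq n w n m (u + 2⁻¹)) ∧
    (∀ (m : ℕ) (u : ℂ),
      Tsolq n w (n - 1) (2 * m + 1) (u - 2⁻¹) * Tsolq n w (n - 1) (2 * m + 1) (u + 2⁻¹) =
        Tsolq n w (n - 1) (2 * m + 2) u * Tsolq n w (n - 1) (2 * m) u +
          Tsolq n w (n - 2) (2 * m + 1) u * Tsolq n w n m u * Tsolq n w n (m + 1) u) ∧
    (∀ m : ℕ, 1 ≤ m → ∀ u : ℂ,
      Tsolq n w n m (u - 1) * Tsolq n w n m (u + 1) =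
        Tsolq n w n (m + 1) u * Tsolq n w n (m - 1) u +
          Tsolq n w (n - 1) (2 * m) u) := by
  have hrefl (k : ℕ) (u : ℂ) :
      xiq n w (n + 2) k u = (-1) ^ (k + 1) * xiq n w n k (u + 1) := by
    have h := hdual (n + 2) k u (by omega)
    rw [show 2 * n + 2 - (n + 2) = n by omega,
      show ((n + 2 : ℕ) : ℤ) - (n : ℤ) - 1 + (k : ℤ) = ((k + 1 : ℕ) : ℤ) by push_cast; ring,
      zpow_natCast, show u + ((n + 2 : ℕ) : ℂ) - (n : ℂ) - 1 = u + 1 by push_cast; ring] at h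
    exact h
  have hanti (u : ℂ) : xiq n w 0 0 (u + 1) = -xiq n w 0 0 u := by
    have h := hrefl 0 u
    rw [xiq_gap_zero, xiq_gap_zero n w n] at h
    rw [h]
    ring
  have hT {a : ℕ} (ha : a < n) (m : ℕ) (v : ℂ) := Tsolq_eq_casoratiT hxi0 hanti ha m v
  refine ⟨fun a m ha₁ ha₂ hm u => ?_, fun m hm u => ?_, fun m u => ?_, fun m hm u => ?_⟩
  · obtain ⟨b, rfl⟩ := Nat.exists_eq_add_of_le' ha₁
    obtain ⟨k, rfl⟩ := Nat.exists_eq_add_of_le' hm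
    rw [hT (by omega), hT (by omega), hT (by omega), hT (by omega), hT (by omega), hT (by omega)]
    exact casoratiT_mul_casoratiT hanti (by omega) k u
  · obtain ⟨k, rfl⟩ := Nat.exists_eq_add_of_le' hm
    have h := casoratiT_mul_casoratiT hanti (a := n - 2) (by omega) (2 * k + 1) u
    rw [show n - 2 + 1 = n - 1 by omega, show n - 2 + 2 = n by omega] at h
    rw [mul_assoc (Tsolq n w (n - 2) _ _), Tsolq_self_mul_even hn hxi0 hxin hodd,
      hT (by omega), hT (by omega), hT (by omega), hT (by omega), hT (by omega)]
    exact h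
  · have h := casoratiT_mul_casoratiT hanti (a := n - 2) (by omega) (2 * m) u
    rw [show n - 2 + 1 = n - 1 by omega, show n - 2 + 2 = n by omega] at h
    rw [mul_assoc (Tsolq n w (n - 2) _ _), Tsolq_self_mul_odd hn hxi0 hxin hodd,
      hT (by omega), hT (by omega), hT (by omega), hT (by omega), hT (by omega)]
    exact h
  · obtain ⟨k, rfl⟩ := Nat.exists_eq_add_of_le' hm
    rw [hT (a := n - 1) (by omega)]
    exact Tsolq_self_mul_self hn hrefl hanti hxi0 hxin hodd k u
end
end
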